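/- arXiv:1404.7582 — 2 statements merged into one kernel-verified Lean document; each statement's English description precedes it below -/
import Mathlib

section
/- Let I be a nonempty closed bounded interval, t₀ ∈ I, and let W : ℝ × ℝ^d → ℝ^d satisfy condition (W) with exponents τ, λ ∈ (0,1], β ≥ 0, and let γ ∈ (0,1] satisfy τ + λγ > 1. Then the map M : C^γ(I; ℝ^d) → C^τ(I; ℝ^d) defined by (Mx)(t) = ∫_{t₀}^t W(ds, x_s) is continuous and compact (i.e., M maps bounded subsets of C^γ(I) to relatively compact subsets of C^τ(I)). -/
open scoped BigOperators

noncomputable section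

/-- `t : Fin (m+1) → ℝ` is a partition `a = t₀ < t₁ < ⋯ < t_m = b` of `[a,b]`. -/
def IsPartition (a b : ℝ) (m : ℕ) (t : Fin (m + 1) → ℝ) : Prop :=
  StrictMono t ∧ t 0 = a ∧ t (Fin.last m) = b

/-- The mesh `|π| = max_i (t_{i+1} - t_i)` of a partition. -/
def partMesh (m : ℕ) (t : Fin (m + 1) → ℝ) : ℝ :=
  ⨆ i : Fin m, (t i.succ - t i.castSucc)

/-- The Riemann sums `Σ_{i=0}^{m-1} μ(t_i, t_{i+1})` over partitions of `[a,b]`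
converge to `I` as the mesh tends to `0`. -/
def RiemannLimit {B : Type*} [NormedAddCommGroup B] (a b : ℝ) (μ : ℝ → ℝ → B) (I : B) : Prop :=
  ∀ ε : ℝ, 0 < ε → ∃ δ : ℝ, 0 < δ ∧ ∀ (m : ℕ) (t : Fin (m + 1) → ℝ),
    IsPartition a b m t → partMesh m t < δ →
    ‖(∑ i : Fin m, μ (t i.castSucc) (t i.succ)) - I‖ < ε

/-- The germ of the nonlinear Young integral `∫ W(ds, φ_s)`:
`(s,t) ↦ W(t, φ_s) − W(s, φ_s)`. -/
def youngGerm {d : ℕ} (W : ℝ → EuclideanSpace ℝ (Fin d) → EuclideanSpace ℝ (Fin d))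
    (φ : ℝ → EuclideanSpace ℝ (Fin d)) : ℝ → ℝ → EuclideanSpace ℝ (Fin d) :=
  fun s t => W t (φ s) - W s (φ s)

/-- `I` is the value of the nonlinear Young integral `∫_a^b W(ds, φ_s)`, i.e. the limit of
the Riemann sums `Σ_i (W(t_{i+1}, φ_{t_i}) − W(t_i, φ_{t_i}))` as the mesh tends to `0`. -/
def HasYoungIntegral {d : ℕ} (W : ℝ → EuclideanSpace ℝ (Fin d) → EuclideanSpace ℝ (Fin d))
    (φ : ℝ → EuclideanSpace ℝ (Fin d)) (a b : ℝ) (I : EuclideanSpace ℝ (Fin d)) : Prop :=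
  RiemannLimit a b (youngGerm W φ) I

/-- The set of quotients entering the Hölder seminorm `‖φ‖_{γ;a,b}`. -/
def holderSet {F : Type*} [NormedAddCommGroup F] (φ : ℝ → F) (γ a b : ℝ) : Set ℝ :=
  {r | ∃ s t : ℝ, a ≤ s ∧ s < t ∧ t ≤ b ∧ r = ‖φ t - φ s‖ / (t - s) ^ γ}

/-- The Hölder seminorm `‖φ‖_{γ;a,b} = sup_{a ≤ s < t ≤ b} ‖φ_t − φ_s‖/(t−s)^γ`. -/
def holderSemi {F : Type*} [NormedAddCommGroup F] (φ : ℝ → F) (γ a b : ℝ) : ℝ :=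
  sSup (holderSet φ γ a b)

/-- `φ` is `γ`-Hölder continuous on `[a,b]`. -/
def HolderOn {F : Type*} [NormedAddCommGroup F] (φ : ℝ → F) (γ a b : ℝ) : Prop :=
  BddAbove (holderSet φ γ a b)

/-- The sup norm `‖φ‖_{∞;a,b} = sup_{a ≤ t ≤ b} ‖φ_t‖`. -/
def supNorm {F : Type*} [NormedAddCommGroup F] (φ : ℝ → F) (a b : ℝ) : ℝ :=
  sSup ((fun u => ‖φ u‖) '' Set.Icc a b)

/-- Quotients of the first term of the seminorm `‖W‖_{β,τ,λ;a,b}` ( = `[W]_{β,τ,λ;a,b}`). -/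
def wSet1 {d : ℕ} (W : ℝ → EuclideanSpace ℝ (Fin d) → EuclideanSpace ℝ (Fin d))
    (β τ lam a b : ℝ) : Set ℝ :=
  {r | ∃ (s t : ℝ) (x y : EuclideanSpace ℝ (Fin d)), a ≤ s ∧ s < t ∧ t ≤ b ∧ x ≠ y ∧
    r = ‖W s x - W t x - W s y + W t y‖ /
      ((1 + ‖x‖ + ‖y‖) ^ β * (t - s) ^ τ * ‖x - y‖ ^ lam)}

/-- Quotients of the second term of the seminorm `‖W‖_{β,τ,λ;a,b}`. -/
def wSet2 {d : ℕ} (W : ℝ → EuclideanSpace ℝ (Fin d) → EuclideanSpace ℝ (Fin d))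
    (β τ lam a b : ℝ) : Set ℝ :=
  {r | ∃ (s t : ℝ) (x : EuclideanSpace ℝ (Fin d)), a ≤ s ∧ s < t ∧ t ≤ b ∧
    r = ‖W s x - W t x‖ / ((1 + ‖x‖) ^ (β + lam) * (t - s) ^ τ)}

/-- Quotients of the third term of the seminorm `‖W‖_{β,τ,λ;a,b}`. -/
def wSet3 {d : ℕ} (W : ℝ → EuclideanSpace ℝ (Fin d) → EuclideanSpace ℝ (Fin d))
    (β τ lam a b : ℝ) : Set ℝ :=
  {r | ∃ (t : ℝ) (x y : EuclideanSpace ℝ (Fin d)), a ≤ t ∧ t ≤ b ∧ x ≠ y ∧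
    r = ‖W t x - W t y‖ / ((1 + ‖x‖ + ‖y‖) ^ β * ‖x - y‖ ^ lam)}

/-- Condition (W) on `[a,b]`: the seminorm `‖W‖_{β,τ,λ;a,b}` is finite. -/
def ConditionW {d : ℕ} (W : ℝ → EuclideanSpace ℝ (Fin d) → EuclideanSpace ℝ (Fin d))
    (β τ lam a b : ℝ) : Prop :=
  BddAbove (wSet1 W β τ lam a b) ∧ BddAbove (wSet2 W β τ lam a b) ∧
    BddAbove (wSet3 W β τ lam a b)

/-- The seminorm `‖W‖_{β,τ,λ;a,b}` (sum of the three suprema). -/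
def wNorm {d : ℕ} (W : ℝ → EuclideanSpace ℝ (Fin d) → EuclideanSpace ℝ (Fin d))
    (β τ lam a b : ℝ) : ℝ :=
  sSup (wSet1 W β τ lam a b) + sSup (wSet2 W β τ lam a b) + sSup (wSet3 W β τ lam a b)

/-- The first supremum `[W]_{β,τ,λ;a,b}` alone. -/
def wBracket {d : ℕ} (W : ℝ → EuclideanSpace ℝ (Fin d) → EuclideanSpace ℝ (Fin d))
    (β τ lam a b : ℝ) : ℝ :=
  sSup (wSet1 W β τ lam a b)


/-- Signed nonlinear Young integral `∫_s^t W(dr, φ_r)` (with the convention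
`∫_s^t = −∫_t^s` when `t < s`). -/
def HasSignedYoungIntegral {d : ℕ}
    (W : ℝ → EuclideanSpace ℝ (Fin d) → EuclideanSpace ℝ (Fin d))
    (φ : ℝ → EuclideanSpace ℝ (Fin d)) (s t : ℝ) (I : EuclideanSpace ℝ (Fin d)) : Prop :=
  (s ≤ t ∧ HasYoungIntegral W φ s t I) ∨ (t < s ∧ HasYoungIntegral W φ t s (-I))

/-- The Hölder norm `‖φ‖_{C^γ([a,b])} = ‖φ‖_{∞;a,b} + ‖φ‖_{γ;a,b}`. -/
def cHolderNorm {F : Type*} [NormedAddCommGroup F] (φ : ℝ → F) (γ a b : ℝ) : ℝ :=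
  supNorm φ a b + holderSemi φ γ a b

/-- Riemann sum along the uniform partition of `[a,b]` with `N` pieces. -/
def unifSum {B : Type*} [NormedAddCommGroup B] (μ : ℝ → ℝ → B) (N : ℕ) (a b : ℝ) : B :=
  ∑ k ∈ Finset.range N,
    μ (a + (k : ℝ) * ((b - a) / N)) (a + ((k + 1 : ℕ) : ℝ) * ((b - a) / N))

lemma riemann_seq {B : Type*} [NormedAddCommGroup B] {a b : ℝ} {μ : ℝ → ℝ → B} {J : B}
    (h : RiemannLimit a b μ J) {ε : ℝ} (hε : 0 < ε) :
    ∃ δ : ℝ, 0 < δ ∧ ∀ (m : ℕ) (f : ℕ → ℝ), f 0 = a → f m = b →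
      (∀ i < m, f i < f (i + 1)) → (∀ i < m, f (i + 1) - f i ≤ δ) →
      ‖(∑ i ∈ Finset.range m, μ (f i) (f (i + 1))) - J‖ < ε := by
  obtain ⟨δ, hδ, H⟩ := h ε hε
  refine ⟨δ / 2, by positivity, fun m f h0 hm hs hd => ?_⟩
  have := H m (fun i => f i.val) ⟨?_, by simpa using h0, by simpa using hm⟩ ?_
  · rw [Finset.sum_range (fun i => μ (f i) (f (i + 1)))]
    simpa using this
  · rw [Fin.strictMono_iff_lt_succ]
    intro i
    simpa using hs i.val i.isLt
  · refine lt_of_le_of_lt (Real.iSup_le (a := δ / 2) (fun i => ?_) (by positivity)) (by linarith)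
    simpa using hd i.val i.isLt

lemma exists_small_step (L δ : ℝ) (hδ : 0 < δ) :
    ∃ N₀ : ℕ, 0 < N₀ ∧ ∀ N : ℕ, N₀ ≤ N → L / N ≤ δ := by
  obtain ⟨n, hn⟩ := exists_nat_gt (L / δ)
  refine ⟨n + 1, by omega, fun N hN => ?_⟩
  have hN' : (n : ℝ) + 1 ≤ N := by exact_mod_cast hN
  have hNpos : (0 : ℝ) < N := by
    have : (0 : ℝ) ≤ n := Nat.cast_nonneg n
    linarith
  rw [div_le_iff₀ hNpos]
  rw [div_lt_iff₀ hδ] at hn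
  nlinarith

lemma unif_tendsto {B : Type*} [NormedAddCommGroup B] {a b : ℝ} {μ : ℝ → ℝ → B} {J : B}
    (h : RiemannLimit a b μ J) (hab : a < b) :
    Filter.Tendsto (fun N => unifSum μ N a b) Filter.atTop (nhds J) := by
  rw [Metric.tendsto_atTop]
  intro ε hε
  obtain ⟨δ, hδ, H⟩ := riemann_seq h hε
  obtain ⟨N₀, hN₀, hN⟩ := exists_small_step (b - a) δ hδ
  refine ⟨N₀, fun N hNN => ?_⟩
  have hNpos : (0 : ℝ) < N := by exact_mod_cast lt_of_lt_of_le hN₀ hNN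
  have hh : 0 < (b - a) / N := div_pos (by linarith) hNpos
  rw [dist_eq_norm]
  refine H N (fun k => a + (k : ℝ) * ((b - a) / N)) (by simp) ?_ ?_ ?_
  · field_simp; ring
  · intro i _; push_cast; nlinarith
  · intro i _
    have := hN N hNN
    push_cast; nlinarith

lemma unif_tendsto_two {B : Type*} [NormedAddCommGroup B] {a b c : ℝ} {μ : ℝ → ℝ → B} {J : B}
    (h : RiemannLimit a c μ J) (hab : a < b) (hbc : b < c) :
    Filter.Tendsto (fun N => unifSum μ N a b + unifSum μ N b c) Filter.atTop (nhds J) := by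
  rw [Metric.tendsto_atTop]
  intro ε hε
  obtain ⟨δ, hδ, H⟩ := riemann_seq h hε
  obtain ⟨N₀, hN₀, hN⟩ := exists_small_step (b - a) δ hδ
  obtain ⟨N₁, hN₁, hN'⟩ := exists_small_step (c - b) δ hδ
  refine ⟨max N₀ N₁, fun N hNN => ?_⟩
  have hNpos : (0 : ℝ) < N := by
    exact_mod_cast lt_of_lt_of_le hN₀ (le_trans (le_max_left _ _) hNN)
  have hN0 : 0 < N := by exact_mod_cast hNpos
  have hh : 0 < (b - a) / N := div_pos (by linarith) hNpos
  have hh' : 0 < (c - b) / N := div_pos (by linarith) hNpos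
  have e1 := hN N (le_trans (le_max_left _ _) hNN)
  have e2 := hN' N (le_trans (le_max_right _ _) hNN)
  have hbb : a + (N : ℝ) * ((b - a) / N) = b := by field_simp; ring
  set f : ℕ → ℝ := fun k => if k ≤ N then a + (k : ℝ) * ((b - a) / N)
    else b + ((k : ℝ) - N) * ((c - b) / N) with hf
  have f1 : ∀ k, k ≤ N → f k = a + (k : ℝ) * ((b - a) / N) := fun k hk => by simp [hf, hk]
  have f2 : ∀ k, f (N + k) = b + (k : ℝ) * ((c - b) / N) := by
    intro k
    rcases Nat.eq_zero_or_pos k with rfl | hk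
    · rw [add_zero, f1 N le_rfl, hbb]; simp
    · have : ¬ (N + k ≤ N) := by omega
      simp only [hf, this, if_false]; push_cast; ring
  have hstep : ∀ i < N + N, f i < f (i + 1) ∧ f (i + 1) - f i ≤ δ := by
    intro i hi
    rcases lt_or_ge i N with hiN | hiN
    · rw [f1 i hiN.le, f1 (i + 1) hiN]
      push_cast
      constructor <;> nlinarith
    · obtain ⟨k, rfl⟩ := Nat.exists_eq_add_of_le hiN
      rw [add_assoc, f2 k, f2 (k + 1)]
      push_cast
      constructor <;> nlinarith
  have key := H (N + N) f (by rw [f1 0 (by omega)]; simp)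
    (by rw [f2]; field_simp; ring) (fun i hi => (hstep i hi).1) (fun i hi => (hstep i hi).2)
  rw [Finset.sum_range_add] at key
  rw [dist_eq_norm]
  have s1 : unifSum μ N a b = ∑ i ∈ Finset.range N, μ (f i) (f (i + 1)) := by
    refine Finset.sum_congr rfl fun k hk => ?_
    have hk := Finset.mem_range.1 hk
    rw [f1 k hk.le, f1 (k + 1) hk]
  have s2 : unifSum μ N b c = ∑ i ∈ Finset.range N, μ (f (N + i)) (f (N + i + 1)) := by
    refine Finset.sum_congr rfl fun k hk => ?_
    rw [add_assoc, f2 k, f2 (k + 1)]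
  rw [s1, s2]
  exact key

lemma riemann_self {B : Type*} [NormedAddCommGroup B] {a : ℝ} {μ : ℝ → ℝ → B} {J : B}
    (h : RiemannLimit a a μ J) : J = 0 := by
  by_contra hJ
  obtain ⟨δ, hδ, H⟩ := riemann_seq h (norm_pos_iff.2 hJ)
  have := H 0 (fun _ => a) rfl rfl (by simp) (by simp)
  simp at this

lemma sum_range_two_mul {B : Type*} [AddCommGroup B] (f : ℕ → B) (N : ℕ) :
    ∑ k ∈ Finset.range (2 * N), f k = ∑ k ∈ Finset.range N, (f (2 * k) + f (2 * k + 1)) := by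
  induction N with
  | zero => simp
  | succ n ih =>
    rw [show 2 * (n + 1) = 2 * n + 1 + 1 by ring, Finset.sum_range_succ, Finset.sum_range_succ,
      Finset.sum_range_succ, ih, add_assoc]

lemma unif_refine {B : Type*} [NormedAddCommGroup B] {μ : ℝ → ℝ → B} {a b K θ : ℝ}
    (hab : a < b)
    (hδ : ∀ s u t, a ≤ s → s ≤ u → u ≤ t → t ≤ b →
      ‖μ s t - μ s u - μ u t‖ ≤ K * (t - s) ^ θ) (N : ℕ) (hN : 0 < N) :
    ‖unifSum μ N a b - unifSum μ (2 * N) a b‖ ≤ N * (K * ((b - a) / N) ^ θ) := by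
  have hNpos : (0 : ℝ) < N := by exact_mod_cast hN
  unfold unifSum
  rw [sum_range_two_mul, ← Finset.sum_sub_distrib]
  have : ∀ k ∈ Finset.range N, ‖μ (a + (k : ℝ) * ((b - a) / N)) (a + ((k + 1 : ℕ) : ℝ) * ((b - a) / N)) -
      (μ (a + ((2 * k : ℕ) : ℝ) * ((b - a) / (2 * N : ℕ))) (a + ((2 * k + 1 : ℕ) : ℝ) * ((b - a) / (2 * N : ℕ))) +
       μ (a + ((2 * k + 1 : ℕ) : ℝ) * ((b - a) / (2 * N : ℕ))) (a + ((2 * k + 1 + 1 : ℕ) : ℝ) * ((b - a) / (2 * N : ℕ))))‖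
      ≤ K * ((b - a) / N) ^ θ := by
    intro k hk
    have hk : (k : ℝ) + 1 ≤ N := by exact_mod_cast Finset.mem_range.1 hk
    set h := (b - a) / N with hh
    have hpos : 0 < h := div_pos (by linarith) hNpos
    have hNh : N * h = b - a := by rw [hh]; field_simp
    have h2 : (b - a) / (2 * N : ℕ) = h / 2 := by rw [hh]; push_cast; field_simp
    rw [h2]
    have k0 : (0 : ℝ) ≤ k := Nat.cast_nonneg k
    have := hδ (a + k * h) (a + (2 * k + 1) * (h / 2)) (a + (k + 1) * h)
      (by nlinarith) (by nlinarith) (by nlinarith) (by nlinarith)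
    rw [show a + (k + 1) * h - (a + k * h) = h by ring] at this
    push_cast
    rw [show a + 2 * (k : ℝ) * (h / 2) = a + k * h by ring,
      show a + (2 * (k : ℝ) + 1 + 1) * (h / 2) = a + (k + 1) * h by ring, ← sub_sub]
    exact this
  refine (norm_sum_le _ _).trans ((Finset.sum_le_sum this).trans ?_)
  simp

lemma sewing {B : Type*} [NormedAddCommGroup B] {μ : ℝ → ℝ → B} {a b K θ : ℝ} {J : B}
    (hab : a < b) (hθ : 1 < θ)
    (hδ : ∀ s u t, a ≤ s → s ≤ u → u ≤ t → t ≤ b →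
      ‖μ s t - μ s u - μ u t‖ ≤ K * (t - s) ^ θ)
    (hJ : Filter.Tendsto (fun N => unifSum μ N a b) Filter.atTop (nhds J)) :
    ‖J - μ a b‖ ≤ K * (b - a) ^ θ / (1 - (2 : ℝ) ^ (1 - θ)) := by
  have hr : (2 : ℝ) ^ (1 - θ) < 1 := Real.rpow_lt_one_of_one_lt_of_neg (by norm_num) (by linarith)
  have hJ2 : Filter.Tendsto (fun n : ℕ => unifSum μ (2 ^ n) a b) Filter.atTop (nhds J) :=
    hJ.comp (tendsto_pow_atTop_atTop_of_one_lt (by norm_num))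
  have := dist_le_of_le_geometric_of_tendsto₀ _ (K * (b - a) ^ θ) hr ?_ hJ2
  · rw [dist_comm, dist_eq_norm] at this
    simpa [unifSum] using this
  · intro n
    have h1 := unif_refine hab hδ (2 ^ n) (by positivity)
    rw [dist_eq_norm, pow_succ, mul_comm (2 ^ n) 2]
    refine h1.trans (le_of_eq ?_)
    push_cast
    rw [Real.div_rpow (by linarith) (by positivity), ← Real.rpow_natCast ((2 : ℝ) ^ (1 - θ)),
      ← Real.rpow_natCast (2 : ℝ), ← Real.rpow_mul (by norm_num), ← Real.rpow_mul (by norm_num),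
      sub_mul, Real.rpow_sub (by norm_num)]
    have : (0 : ℝ) < 2 ^ (θ * n) := by positivity
    rw [one_mul, mul_comm (n : ℝ) θ]
    field_simp

/-- `F` is, locally on each side of `t₀`, the sewing of the germ `μ`. -/
def IsSewn {B : Type*} [NormedAddCommGroup B] (μ : ℝ → ℝ → B) (F : ℝ → B) (a b t₀ : ℝ) : Prop :=
  ∀ s t, a ≤ s → s < t → t ≤ b → (t₀ ≤ s ∨ t ≤ t₀) →
    Filter.Tendsto (fun N => unifSum μ N s t) Filter.atTop (nhds (F t - F s))

lemma IsSewn.sub {B : Type*} [NormedAddCommGroup B] {μ ν : ℝ → ℝ → B} {F G : ℝ → B}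
    {a b t₀ : ℝ} (h : IsSewn μ F a b t₀) (h' : IsSewn ν G a b t₀) :
    IsSewn (fun s t => μ s t - ν s t) (fun t => F t - G t) a b t₀ := by
  intro s t hs hst ht ho
  have := (h s t hs hst ht ho).sub (h' s t hs hst ht ho)
  have e : F t - G t - (F s - G s) = F t - F s - (G t - G s) := by abel
  simp only [e]
  refine this.congr fun N => ?_
  simp [unifSum, Finset.sum_sub_distrib]

lemma IsSewn.bound {B : Type*} [NormedAddCommGroup B] {μ : ℝ → ℝ → B} {F : ℝ → B}
    {a b t₀ A K τ θ : ℝ} (h : IsSewn μ F a b t₀) (hA : 0 ≤ A) (hK : 0 ≤ K)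
    (hτ : 0 < τ) (hτθ : τ ≤ θ) (hθ : 1 < θ)
    (hμ : ∀ s t, a ≤ s → s ≤ t → t ≤ b → ‖μ s t‖ ≤ A * (t - s) ^ τ)
    (hδ : ∀ s u t, a ≤ s → s ≤ u → u ≤ t → t ≤ b →
      ‖μ s t - μ s u - μ u t‖ ≤ K * (t - s) ^ θ) :
    ∀ s t, a ≤ s → s < t → t ≤ b →
      ‖F t - F s‖ ≤ 2 * (A + K * ((b - a) ^ (θ - τ) / (1 - (2 : ℝ) ^ (1 - θ)))) * (t - s) ^ τ := by
  have hr : 0 < 1 - (2 : ℝ) ^ (1 - θ) :=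
    sub_pos.2 (Real.rpow_lt_one_of_one_lt_of_neg (by norm_num) (by linarith))
  set r := 1 - (2 : ℝ) ^ (1 - θ)
  have one : ∀ s t, a ≤ s → s < t → t ≤ b → (t₀ ≤ s ∨ t ≤ t₀) →
      ‖F t - F s‖ ≤ (A + K * ((b - a) ^ (θ - τ) / r)) * (t - s) ^ τ := by
    intro s t hs hst ht ho
    have hts : 0 < t - s := by linarith
    have h1 := sewing hst hθ (fun s' u t' h1 h2 h3 h4 =>
      hδ s' u t' (hs.trans h1) h2 h3 (h4.trans ht)) (h s t hs hst ht ho)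
    have h2 := hμ s t hs hst.le ht
    have h3 : (t - s) ^ θ ≤ (b - a) ^ (θ - τ) * (t - s) ^ τ := by
      rw [show (t - s) ^ θ = (t - s) ^ (θ - τ) * (t - s) ^ τ by
        rw [← Real.rpow_add hts]; ring_nf]
      gcongr
    calc ‖F t - F s‖ = ‖(F t - F s - μ s t) + μ s t‖ := by congr 1; abel
      _ ≤ K * (t - s) ^ θ / r + A * (t - s) ^ τ := (norm_add_le _ _).trans (add_le_add h1 h2)
      _ ≤ K * ((b - a) ^ (θ - τ) * (t - s) ^ τ) / r + A * (t - s) ^ τ := by gcongr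
      _ = _ := by ring
  intro s t hs hst ht
  have hba : 0 ≤ b - a := by linarith
  set Q := A + K * ((b - a) ^ (θ - τ) / r)
  have hQ : 0 ≤ Q := by positivity
  have hp : 0 ≤ (t - s) ^ τ := Real.rpow_nonneg (by linarith) _
  by_cases ho : t₀ ≤ s ∨ t ≤ t₀
  · have := one s t hs hst ht ho
    nlinarith [mul_nonneg hQ hp]
  · push Not at ho
    have h1 := one s t₀ hs ho.1 (by linarith) (Or.inr le_rfl)
    have h2 := one t₀ t (by linarith) ho.2 ht (Or.inl le_rfl)
    have h3 : (t₀ - s) ^ τ ≤ (t - s) ^ τ := by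
      apply Real.rpow_le_rpow <;> linarith
    have h4 : (t - t₀) ^ τ ≤ (t - s) ^ τ := by
      apply Real.rpow_le_rpow <;> linarith
    calc ‖F t - F s‖ = ‖(F t - F t₀) + (F t₀ - F s)‖ := by congr 1; abel
      _ ≤ Q * (t - t₀) ^ τ + Q * (t₀ - s) ^ τ := (norm_add_le _ _).trans (add_le_add h2 h1)
      _ ≤ Q * (t - s) ^ τ + Q * (t - s) ^ τ := by gcongr
      _ = _ := by ring

lemma isSewn_of_integral {d : ℕ} {W : ℝ → EuclideanSpace ℝ (Fin d) → EuclideanSpace ℝ (Fin d)}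
    {x F : ℝ → EuclideanSpace ℝ (Fin d)} {a b t₀ : ℝ} (ht₀ : t₀ ∈ Set.Icc a b)
    (h : ∀ t ∈ Set.Icc a b, HasSignedYoungIntegral W x t₀ t (F t)) :
    F t₀ = 0 ∧ IsSewn (youngGerm W x) F a b t₀ := by
  have h0 : F t₀ = 0 := by
    rcases h t₀ ht₀ with h | h
    · exact riemann_self h.2
    · exact absurd h.1 (lt_irrefl _)
  refine ⟨h0, ?_⟩
  intro s t hs hst ht ho
  rcases ho with ho | ho
  · have Ht : RiemannLimit t₀ t (youngGerm W x) (F t) := by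
      rcases h t ⟨by linarith, ht⟩ with h | h
      · exact h.2
      · linarith [h.1]
    rcases ho.eq_or_lt with rfl | ho
    · rw [h0, sub_zero]
      exact unif_tendsto Ht hst
    · have Hs : RiemannLimit t₀ s (youngGerm W x) (F s) := by
        rcases h s ⟨hs, by linarith⟩ with h | h
        · exact h.2
        · linarith [h.1]
      simpa using (unif_tendsto_two Ht ho hst).sub (unif_tendsto Hs ho)
  · have Hs : RiemannLimit s t₀ (youngGerm W x) (-F s) := by
      rcases h s ⟨hs, by linarith⟩ with h | h
      · linarith [h.1]
      · exact h.2
    rcases ho.eq_or_lt with rfl | ho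
    · rw [h0, zero_sub]
      exact unif_tendsto Hs hst
    · have Ht : RiemannLimit t t₀ (youngGerm W x) (-F t) := by
        rcases h t ⟨by linarith, ht⟩ with h | h
        · linarith [h.1]
        · exact h.2
      have := (unif_tendsto_two Hs hst ho).sub (unif_tendsto Ht ho)
      rw [show F t - F s = -F s - -F t by abel]
      simpa using this

lemma condW_bounds {d : ℕ} {W : ℝ → EuclideanSpace ℝ (Fin d) → EuclideanSpace ℝ (Fin d)}
    {β τ lam a b : ℝ} (hτ : 0 < τ) (hlam : 0 < lam)
    (hW : ConditionW W β τ lam a b) :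
    ∃ K : ℝ, 0 ≤ K ∧
      (∀ s t x y, a ≤ s → s ≤ t → t ≤ b → ‖W s x - W t x - W s y + W t y‖ ≤
        K * ((1 + ‖x‖ + ‖y‖) ^ β * (t - s) ^ τ * ‖x - y‖ ^ lam)) ∧
      (∀ s t x, a ≤ s → s ≤ t → t ≤ b → ‖W s x - W t x‖ ≤
        K * ((1 + ‖x‖) ^ (β + lam) * (t - s) ^ τ)) := by
  obtain ⟨⟨K₁, h₁⟩, ⟨K₂, h₂⟩, -⟩ := hW
  refine ⟨max 0 (max K₁ K₂), le_max_left _ _, ?_, ?_⟩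
  · intro s t x y hs hst ht
    rcases hst.eq_or_lt with rfl | hst
    · have : W s x - W s x - W s y + W s y = 0 := by abel
      rw [this, sub_self, Real.zero_rpow hτ.ne']; simp
    rcases eq_or_ne x y with rfl | hxy
    · have : W s x - W t x - W s x + W t x = 0 := by abel
      rw [this, sub_self, norm_zero, Real.zero_rpow hlam.ne']; simp
    have := h₁ ⟨s, t, x, y, hs, hst, ht, hxy, rfl⟩
    have hts : 0 < t - s := by linarith
    have hn : 0 < ‖x - y‖ := norm_pos_iff.2 (sub_ne_zero.2 hxy)
    rw [div_le_iff₀ (by positivity)] at this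
    refine this.trans ?_
    gcongr
    exact (le_max_left _ _).trans (le_max_right _ _)
  · intro s t x hs hst ht
    rcases hst.eq_or_lt with rfl | hst
    · rw [sub_self, sub_self, Real.zero_rpow hτ.ne']; simp
    have := h₂ ⟨s, t, x, hs, hst, ht, rfl⟩
    have hts : 0 < t - s := by linarith
    rw [div_le_iff₀ (by positivity)] at this
    refine this.trans ?_
    gcongr
    exact (le_max_right _ _).trans (le_max_right _ _)

/-- Quantitative membership in the ball of radius `R` of the Hölder space. -/
def GoodBd {F : Type*} [NormedAddCommGroup F] (x : ℝ → F) (γ a b R : ℝ) : Prop :=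
  (∀ t, a ≤ t → t ≤ b → ‖x t‖ ≤ R) ∧
  (∀ s t, a ≤ s → s ≤ t → t ≤ b → ‖x t - x s‖ ≤ R * (t - s) ^ γ)

lemma holder_le {F : Type*} [NormedAddCommGroup F] {x : ℝ → F} {γ a b : ℝ} (hγ : 0 < γ)
    (h : HolderOn x γ a b) : ∀ s t, a ≤ s → s ≤ t → t ≤ b →
      ‖x t - x s‖ ≤ holderSemi x γ a b * (t - s) ^ γ := by
  intro s t hs hst ht
  rcases hst.eq_or_lt with rfl | hst
  · simp [Real.zero_rpow hγ.ne']
  have hts : 0 < t - s := by linarith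
  have := le_csSup h ⟨s, t, hs, hst, ht, rfl⟩
  rwa [div_le_iff₀ (by positivity)] at this

lemma holderSemi_nonneg {F : Type*} [NormedAddCommGroup F] (x : ℝ → F) (γ a b : ℝ) :
    0 ≤ holderSemi x γ a b := by
  refine Real.sSup_nonneg ?_
  rintro r ⟨s, t, _, hst, _, rfl⟩
  have hts : 0 < t - s := by linarith
  positivity

lemma supNorm_nonneg {F : Type*} [NormedAddCommGroup F] (x : ℝ → F) (a b : ℝ) :
    0 ≤ supNorm x a b := by
  refine Real.sSup_nonneg ?_
  rintro r ⟨s, _, rfl⟩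
  positivity

lemma le_supNorm {F : Type*} [NormedAddCommGroup F] {x : ℝ → F} {γ a b : ℝ} (hγ : 0 < γ)
    (h : HolderOn x γ a b) : ∀ t, a ≤ t → t ≤ b → ‖x t‖ ≤ supNorm x a b := by
  intro t hat htb
  refine le_csSup ⟨‖x a‖ + holderSemi x γ a b * (b - a) ^ γ, ?_⟩ ⟨t, ⟨hat, htb⟩, rfl⟩
  rintro r ⟨u, ⟨hu, hu'⟩, rfl⟩
  have h1 := holder_le hγ h a u le_rfl hu hu'
  have h2 : (u - a) ^ γ ≤ (b - a) ^ γ := by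
    apply Real.rpow_le_rpow <;> linarith
  have h3 := mul_le_mul_of_nonneg_left h2 (holderSemi_nonneg x γ a b)
  have h4 : ‖x u‖ ≤ ‖x a‖ + ‖x u - x a‖ := norm_le_norm_add_norm_sub' _ _
  simp only
  linarith

lemma good_of_holder {F : Type*} [NormedAddCommGroup F] {x : ℝ → F} {γ a b R : ℝ} (hγ : 0 < γ)
    (h : HolderOn x γ a b) (hR : cHolderNorm x γ a b ≤ R) : GoodBd x γ a b R := by
  have h1 := supNorm_nonneg x a b
  have h2 := holderSemi_nonneg x γ a b
  unfold cHolderNorm at hR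
  refine ⟨fun t ha hb => (le_supNorm hγ h t ha hb).trans (by linarith), ?_⟩
  intro s t hs hst ht
  refine (holder_le hγ h s t hs hst ht).trans ?_
  have : 0 ≤ (t - s) ^ γ := Real.rpow_nonneg (by linarith) _
  gcongr
  linarith

lemma holderOn_of_le {F : Type*} [NormedAddCommGroup F] {x : ℝ → F} {γ a b C : ℝ}
    (h : ∀ s t, a ≤ s → s < t → t ≤ b → ‖x t - x s‖ ≤ C * (t - s) ^ γ) : HolderOn x γ a b := by
  refine ⟨C, ?_⟩
  rintro r ⟨s, t, hs, hst, ht, rfl⟩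
  have hts : 0 < t - s := by linarith
  rw [div_le_iff₀ (by positivity)]
  exact h s t hs hst ht

lemma cHolderNorm_le {F : Type*} [NormedAddCommGroup F] {x : ℝ → F} {γ a b t₀ C : ℝ}
    (hγ : 0 < γ) (ht₀ : t₀ ∈ Set.Icc a b) (h0 : x t₀ = 0) (hC : 0 ≤ C)
    (h : ∀ s t, a ≤ s → s < t → t ≤ b → ‖x t - x s‖ ≤ C * (t - s) ^ γ) :
    cHolderNorm x γ a b ≤ C * ((b - a) ^ γ + 1) := by
  have hba : 0 ≤ b - a := by linarith [ht₀.1, ht₀.2]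
  have h1 : supNorm x a b ≤ C * (b - a) ^ γ := by
    refine Real.sSup_le ?_ (by positivity)
    rintro r ⟨t, ⟨ha, hb⟩, rfl⟩
    simp only
    rcases lt_trichotomy t t₀ with hlt | rfl | hlt
    · have := h t t₀ ha hlt ht₀.2
      rw [h0, zero_sub, norm_neg] at this
      refine this.trans ?_
      have : (t₀ - t) ^ γ ≤ (b - a) ^ γ := by
        apply Real.rpow_le_rpow <;> linarith [ht₀.1, ht₀.2]
      gcongr
    · rw [h0, norm_zero]; positivity
    · have := h t₀ t ht₀.1 hlt hb
      rw [h0, sub_zero] at this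
      refine this.trans ?_
      have : (t - t₀) ^ γ ≤ (b - a) ^ γ := by
        apply Real.rpow_le_rpow <;> linarith [ht₀.1, ht₀.2]
      gcongr
  have h2 : holderSemi x γ a b ≤ C := by
    refine Real.sSup_le ?_ hC
    rintro r ⟨s, t, hs, hst, ht, rfl⟩
    have hts : 0 < t - s := by linarith
    rw [div_le_iff₀ (by positivity)]
    exact h s t hs hst ht
  unfold cHolderNorm
  linarith

lemma key_single {d : ℕ} {W : ℝ → EuclideanSpace ℝ (Fin d) → EuclideanSpace ℝ (Fin d)}
    {β τ lam γ a b t₀ K R : ℝ} (hβ : 0 ≤ β) (hτ : 0 < τ) (hlam : 0 < lam) (hγ : 0 < γ)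
    (hsum : 1 < τ + lam * γ) (hK : 0 ≤ K) (hR : 0 ≤ R)
    (hW1 : ∀ s t x y, a ≤ s → s ≤ t → t ≤ b → ‖W s x - W t x - W s y + W t y‖ ≤
        K * ((1 + ‖x‖ + ‖y‖) ^ β * (t - s) ^ τ * ‖x - y‖ ^ lam))
    (hW2 : ∀ s t x, a ≤ s → s ≤ t → t ≤ b → ‖W s x - W t x‖ ≤
        K * ((1 + ‖x‖) ^ (β + lam) * (t - s) ^ τ)) :
    ∃ C : ℝ, ∀ x F : ℝ → EuclideanSpace ℝ (Fin d), GoodBd x γ a b R →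
      IsSewn (youngGerm W x) F a b t₀ →
      ∀ s t, a ≤ s → s < t → t ≤ b → ‖F t - F s‖ ≤ C * (t - s) ^ τ := by
  refine ⟨_, fun x F hx hF => hF.bound (A := K * (1 + R) ^ (β + lam))
    (K := K * ((1 + R + R) ^ β * R ^ lam)) (θ := τ + lam * γ) (by positivity) (by positivity) hτ
    (by nlinarith [mul_pos hlam hγ]) hsum ?_ ?_⟩
  · intro s t hs hst ht
    have hts : 0 ≤ t - s := by linarith
    have h1 := hW2 s t (x s) hs hst ht
    have h2 := hx.1 s hs (hst.trans ht)
    unfold youngGerm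
    rw [norm_sub_rev, mul_assoc]
    refine h1.trans ?_
    gcongr
  · intro s u t hs hsu hut ht
    have hus : 0 ≤ u - s := by linarith
    have htu : 0 ≤ t - u := by linarith
    have hts : 0 ≤ t - s := by linarith
    have h1 := hW1 u t (x u) (x s) (hs.trans hsu) hut ht
    have h2 := hx.1 s hs (by linarith)
    have h3 := hx.1 u (by linarith) (by linarith)
    have h4 := hx.2 s u hs hsu (by linarith)
    have e : youngGerm W x s t - youngGerm W x s u - youngGerm W x u t =
        W u (x u) - W t (x u) - W u (x s) + W t (x s) := by
      unfold youngGerm; abel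
    rw [e]
    refine h1.trans ?_
    calc K * ((1 + ‖x u‖ + ‖x s‖) ^ β * (t - u) ^ τ * ‖x u - x s‖ ^ lam)
        ≤ K * ((1 + R + R) ^ β * (t - s) ^ τ * (R * (t - s) ^ γ) ^ lam) := by
          have h5 : ‖x u - x s‖ ≤ R * (t - s) ^ γ := h4.trans (by gcongr)
          gcongr
      _ = K * ((1 + R + R) ^ β * R ^ lam) * (t - s) ^ (τ + lam * γ) := by
          rw [Real.mul_rpow hR (by positivity), ← Real.rpow_mul hts, Real.rpow_add' hts (by linarith),
            mul_comm γ lam]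
          ring

lemma min_interp {z p q θ : ℝ} (hz : 0 ≤ z) (hθ0 : 0 ≤ θ) (hθ1 : θ ≤ 1)
    (hp : z ≤ p) (hq : z ≤ q) : z ≤ p ^ θ * q ^ (1 - θ) := by
  calc z = z ^ (θ + (1 - θ)) := by simp
    _ = z ^ θ * z ^ (1 - θ) := Real.rpow_add' hz (by simp)
    _ ≤ _ := by
      have : 0 ≤ 1 - θ := by linarith
      have := hz.trans hp
      gcongr

lemma key_double {d : ℕ} {W : ℝ → EuclideanSpace ℝ (Fin d) → EuclideanSpace ℝ (Fin d)}
    {β τ lam γ a b t₀ K R θ : ℝ} (hab : a ≤ b) (hβ : 0 ≤ β) (hτ : 0 < τ) (hlam : 0 < lam) (hγ : 0 < γ)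
    (hθ0 : 0 < θ) (hθ1 : θ < 1)
    (hsum : 1 < τ + θ * (lam * γ)) (hK : 0 ≤ K) (hR : 0 ≤ R)
    (hW1 : ∀ s t x y, a ≤ s → s ≤ t → t ≤ b → ‖W s x - W t x - W s y + W t y‖ ≤
        K * ((1 + ‖x‖ + ‖y‖) ^ β * (t - s) ^ τ * ‖x - y‖ ^ lam)) :
    ∃ C : ℝ, 0 ≤ C ∧ ∀ (x y F G : ℝ → EuclideanSpace ℝ (Fin d)) (ε : ℝ), 0 ≤ ε →
      GoodBd x γ a b R → GoodBd y γ a b R → (∀ t, a ≤ t → t ≤ b → ‖x t - y t‖ ≤ ε) →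
      IsSewn (youngGerm W x) F a b t₀ → IsSewn (youngGerm W y) G a b t₀ →
      ∀ s t, a ≤ s → s < t → t ≤ b → ‖(F t - G t) - (F s - G s)‖ ≤
        C * (ε ^ lam + (ε ^ lam) ^ (1 - θ)) * (t - s) ^ τ := by
  obtain ⟨P, hP⟩ : ∃ P, P = K * (1 + R + R) ^ β := ⟨_, rfl⟩
  have hP0 : 0 ≤ P := by rw [hP]; positivity
  obtain ⟨D, hD⟩ : ∃ D, D = (b - a) ^ (τ + θ * (lam * γ) - τ) /
    (1 - (2 : ℝ) ^ (1 - (τ + θ * (lam * γ)))) := ⟨_, rfl⟩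
  have hD0 : 0 ≤ D := by
    have hr : 0 < 1 - (2 : ℝ) ^ (1 - (τ + θ * (lam * γ))) :=
      sub_pos.2 (Real.rpow_lt_one_of_one_lt_of_neg (by norm_num) (by linarith))
    have : 0 ≤ b - a := by linarith
    rw [hD]; positivity
  refine ⟨2 * (P + 2 * P * (R ^ lam) ^ θ * D), by positivity, ?_⟩
  intro x y F G ε hε hx hy hxy hF hG s t hs hst ht
  have wb : ∀ s t v w, a ≤ s → s ≤ t → t ≤ b → ‖v‖ ≤ R → ‖w‖ ≤ R →
      ‖W s v - W t v - W s w + W t w‖ ≤ P * ((t - s) ^ τ * ‖v - w‖ ^ lam) := by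
    intro s t v w hs hst ht hv hw
    have hts : 0 ≤ t - s := by linarith
    refine (hW1 s t v w hs hst ht).trans ?_
    rw [hP, mul_assoc K, ← mul_assoc ((1 + R + R) ^ β)]
    gcongr
  have := (hF.sub hG).bound (A := P * ε ^ lam)
    (K := 2 * P * (R ^ lam) ^ θ * (ε ^ lam) ^ (1 - θ)) (τ := τ)
    (θ := τ + θ * (lam * γ)) (by positivity) (by positivity) hτ
    (by nlinarith [mul_pos hθ0 (mul_pos hlam hγ)]) hsum ?_ ?_ s t hs hst ht
  · refine this.trans ?_
    have hts : 0 ≤ t - s := by linarith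
    have h1 : 0 ≤ ε ^ lam := by positivity
    have h2 : 0 ≤ (ε ^ lam) ^ (1 - θ) := by positivity
    rw [← hD]
    refine mul_le_mul_of_nonneg_right ?_ (Real.rpow_nonneg hts _)
    clear this
    generalize ε ^ lam = e1 at *
    generalize e1 ^ (1 - θ) = e2 at *
    have h3 : 0 ≤ 2 * P * (R ^ lam) ^ θ * D := by positivity
    nlinarith [mul_nonneg hP0 h2, mul_nonneg h3 h1]
  · intro s t hs hst ht
    have hts : 0 ≤ t - s := by linarith
    have h1 := wb s t (x s) (y s) hs hst ht (hx.1 s hs (by linarith)) (hy.1 s hs (by linarith))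
    have h2 := hxy s hs (by linarith)
    have e : youngGerm W x s t - youngGerm W y s t =
        -(W s (x s) - W t (x s) - W s (y s) + W t (y s)) := by
      unfold youngGerm; abel
    rw [e, norm_neg]
    refine h1.trans ?_
    rw [mul_assoc, mul_comm (ε ^ lam)]
    gcongr
  · intro s u t hs hsu hut ht
    have hus : 0 ≤ u - s := by linarith
    have htu : 0 ≤ t - u := by linarith
    have hts : 0 ≤ t - s := by linarith
    have hau : a ≤ u := by linarith
    have hub : u ≤ b := by linarith
    have hsb : s ≤ b := by linarith
    have nx1 := wb u t (x u) (x s) hau hut ht (hx.1 u hau hub) (hx.1 s hs hsb)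
    have ny1 := wb u t (y u) (y s) hau hut ht (hy.1 u hau hub) (hy.1 s hs hsb)
    have nu := wb u t (x u) (y u) hau hut ht (hx.1 u hau hub) (hy.1 u hau hub)
    have ns := wb u t (x s) (y s) hau hut ht (hx.1 s hs hsb) (hy.1 s hs hsb)
    have hτle : (t - u) ^ τ ≤ (t - s) ^ τ := by gcongr; 
    have gle : (u - s) ^ γ ≤ (t - s) ^ γ := by gcongr
    have bx : ‖x u - x s‖ ≤ R * (t - s) ^ γ := (hx.2 s u hs hsu hub).trans (by gcongr)
    have b_y : ‖y u - y s‖ ≤ R * (t - s) ^ γ := (hy.2 s u hs hsu hub).trans (by gcongr)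
    have du := hxy u hau hub
    have ds := hxy s hs hsb
    have mono : ∀ v q : ℝ, 0 ≤ v → v ≤ q → P * ((t - u) ^ τ * v ^ lam) ≤
        P * (t - s) ^ τ * q ^ lam := by
      intro v q hv hvq
      rw [mul_assoc]
      gcongr
    replace nx1 := nx1.trans (mono _ _ (norm_nonneg _) bx)
    replace ny1 := ny1.trans (mono _ _ (norm_nonneg _) b_y)
    replace nu := nu.trans (mono _ _ (norm_nonneg _) du)
    replace ns := ns.trans (mono _ _ (norm_nonneg _) ds)
    set Z := youngGerm W x s t - youngGerm W y s t - (youngGerm W x s u - youngGerm W y s u) -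
      (youngGerm W x u t - youngGerm W y u t) with hZ
    have e1 : Z = (W u (x u) - W t (x u) - W u (x s) + W t (x s)) -
        (W u (y u) - W t (y u) - W u (y s) + W t (y s)) := by
      rw [hZ]; unfold youngGerm; abel
    have e2 : Z = (W u (x u) - W t (x u) - W u (y u) + W t (y u)) -
        (W u (x s) - W t (x s) - W u (y s) + W t (y s)) := by
      rw [hZ]; unfold youngGerm; abel
    obtain ⟨T, hT⟩ : ∃ T, T = 2 * P * (t - s) ^ τ := ⟨_, rfl⟩
    have hT0 : 0 ≤ T := by rw [hT]; positivity
    have z1 : ‖Z‖ ≤ T * (R * (t - s) ^ γ) ^ lam := by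
      rw [e1]
      refine (norm_sub_le _ _).trans ((add_le_add nx1 ny1).trans (le_of_eq ?_))
      rw [hT]; ring
    have z2 : ‖Z‖ ≤ T * ε ^ lam := by
      rw [e2]
      refine (norm_sub_le _ _).trans ((add_le_add nu ns).trans (le_of_eq ?_))
      rw [hT]; ring
    refine (min_interp (norm_nonneg Z) hθ0.le hθ1.le z1 z2).trans (le_of_eq ?_)
    have hTT : T ^ θ * T ^ (1 - θ) = T := by
      rw [← Real.rpow_add' hT0 (by simp)]; simp
    rw [Real.mul_rpow hT0 (by positivity), Real.mul_rpow hT0 (by positivity),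
      Real.mul_rpow hR (by positivity), Real.mul_rpow (by positivity) (by positivity),
      ← Real.rpow_mul hts, ← Real.rpow_mul hts, Real.rpow_add' hts (by linarith),
      show γ * lam * θ = θ * (lam * γ) by ring]
    calc _ = (T ^ θ * T ^ (1 - θ)) * (R ^ lam) ^ θ * (t - s) ^ (θ * (lam * γ)) *
          (ε ^ lam) ^ (1 - θ) := by ring
      _ = _ := by rw [hTT, hT]; ring

lemma ascoli {d : ℕ} {γ a b R : ℝ} (hab : a ≤ b) (hγ : 0 < γ)
    (x : ℕ → ℝ → EuclideanSpace ℝ (Fin d)) (hx : ∀ n, GoodBd (x n) γ a b R) :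
    ∃ ns : ℕ → ℕ, StrictMono ns ∧ ∃ y : ℝ → EuclideanSpace ℝ (Fin d), GoodBd y γ a b R ∧
      ∃ e : ℕ → ℝ, (∀ k, 0 ≤ e k) ∧ Filter.Tendsto e Filter.atTop (nhds 0) ∧
        ∀ k t, a ≤ t → t ≤ b → ‖x (ns k) t - y t‖ ≤ e k := by
  have hR : 0 ≤ R := (norm_nonneg _).trans ((hx 0).1 a le_rfl hab)
  have hd : ∀ n (s t : Set.Icc a b), dist (x n s) (x n t) ≤ R * (dist s t) ^ γ := by
    intro n s t
    rcases le_total (s : ℝ) t with hst | hst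
    · have := (hx n).2 s t s.2.1 hst t.2.2
      rwa [dist_comm, dist_eq_norm, Subtype.dist_eq, dist_comm, Real.dist_eq,
        abs_of_nonneg (by linarith)]
    · have := (hx n).2 t s t.2.1 hst s.2.2
      rwa [dist_eq_norm, Subtype.dist_eq, Real.dist_eq, abs_of_nonneg (by linarith)]
  have hlim : Filter.Tendsto (fun r : ℝ => R * r ^ γ) (nhds 0) (nhds 0) := by
    have : Continuous (fun r : ℝ => R * r ^ γ) :=
      continuous_const.mul (Real.continuous_rpow_const hγ.le)
    simpa [Real.zero_rpow hγ.ne'] using this.tendsto 0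
  have hequi : UniformEquicontinuous (fun n (t : Set.Icc a b) => x n t) := by
    refine Metric.uniformEquicontinuous_of_continuity_modulus _ hlim _ ?_
    intro s t n
    exact hd n s t
  let f : ℕ → BoundedContinuousFunction (Set.Icc a b) (EuclideanSpace ℝ (Fin d)) := fun n =>
    BoundedContinuousFunction.mkOfCompact ⟨fun t => x n t, hequi.equicontinuous.continuous n⟩
  have hcomp : IsCompact (closure (Set.range f)) := by
    refine BoundedContinuousFunction.arzela_ascoli (Metric.closedBall 0 R)
      (isCompact_closedBall _ _) (Set.range f) ?_ ?_
    · rintro _ t ⟨n, rfl⟩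
      simpa [f] using (hx n).1 t t.2.1 t.2.2
    · intro t U hU
      filter_upwards [hequi.equicontinuous t U hU] with s hs
      rintro ⟨_, n, rfl⟩
      exact hs n
  obtain ⟨g, -, ns, hns, hg⟩ := hcomp.tendsto_subseq
    (fun n => subset_closure (Set.mem_range_self (f := f) n))
  have hpt : ∀ t : Set.Icc a b, Filter.Tendsto (fun k => x (ns k) t) Filter.atTop (nhds (g t)) := by
    intro t
    exact ((BoundedContinuousFunction.tendsto_iff_tendstoUniformly.1 hg).tendsto_at t)
  refine ⟨ns, hns, fun t => g (Set.projIcc a b hab t), ⟨?_, ?_⟩, fun k => dist (f (ns k)) g,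
    fun k => dist_nonneg, ?_, ?_⟩
  · intro t ha hb
    simp only [Set.projIcc_of_mem hab ⟨ha, hb⟩]
    exact le_of_tendsto (hpt ⟨t, ha, hb⟩).norm (Filter.Eventually.of_forall fun k =>
      (hx _).1 t ha hb)
  · intro s t hs hst ht
    simp only [Set.projIcc_of_mem hab ⟨hs, hst.trans ht⟩, Set.projIcc_of_mem hab ⟨hs.trans hst, ht⟩]
    exact le_of_tendsto ((hpt ⟨t, hs.trans hst, ht⟩).sub (hpt ⟨s, hs, hst.trans ht⟩)).norm
      (Filter.Eventually.of_forall fun k => (hx _).2 s t hs hst ht)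
  · exact tendsto_iff_dist_tendsto_zero.1 hg
  · intro k t ha hb
    simp only [Set.projIcc_of_mem hab ⟨ha, hb⟩]
    rw [← dist_eq_norm]
    exact BoundedContinuousFunction.dist_coe_le_dist (f := f (ns k)) (g := g) ⟨t, ha, hb⟩

/-- **Continuity and compactness of the nonlinear Young integral map**
(Corollary 2.12): under condition (W) with `τ + λγ > 1`, the map
`M : C^γ(I) → C^τ(I)`, `(Mx)(t) = ∫_{t₀}^t W(ds, x_s)`, is well defined, continuous,
and maps bounded subsets of `C^γ(I)` to relatively compact subsets of `C^τ(I)`. -/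
theorem young_map_continuous_and_compact
    (d : ℕ) (W : ℝ → EuclideanSpace ℝ (Fin d) → EuclideanSpace ℝ (Fin d))
    (β τ lam γ a₀ b₀ t₀ : ℝ)
    (hI : a₀ ≤ b₀) (ht₀ : t₀ ∈ Set.Icc a₀ b₀) (hβ : 0 ≤ β)
    (hτ : τ ∈ Set.Ioc (0 : ℝ) 1) (hlam : lam ∈ Set.Ioc (0 : ℝ) 1) (hγ : γ ∈ Set.Ioc (0 : ℝ) 1)
    (hsum : 1 < τ + lam * γ)
    (hW : ∀ a b : ℝ, a < b → ConditionW W β τ lam a b)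
    (M : (ℝ → EuclideanSpace ℝ (Fin d)) → (ℝ → EuclideanSpace ℝ (Fin d)))
    (hM : ∀ x : ℝ → EuclideanSpace ℝ (Fin d), HolderOn x γ a₀ b₀ →
      ∀ t ∈ Set.Icc a₀ b₀, HasSignedYoungIntegral W x t₀ t (M x t)) :
    -- `M` maps `C^γ(I)` into `C^τ(I)`
    (∀ x : ℝ → EuclideanSpace ℝ (Fin d), HolderOn x γ a₀ b₀ → HolderOn (M x) τ a₀ b₀) ∧
    -- `M` is continuous from `C^γ(I)` to `C^τ(I)`
    (∀ x : ℝ → EuclideanSpace ℝ (Fin d), HolderOn x γ a₀ b₀ →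
      ∀ ε : ℝ, 0 < ε → ∃ δ : ℝ, 0 < δ ∧
        ∀ y : ℝ → EuclideanSpace ℝ (Fin d), HolderOn y γ a₀ b₀ →
          cHolderNorm (fun t => y t - x t) γ a₀ b₀ < δ →
          cHolderNorm (fun t => M y t - M x t) τ a₀ b₀ < ε) ∧
    -- `M` maps bounded sets to relatively compact sets: every sequence in the image of a
    -- bounded set has a subsequence converging in `C^τ(I)`
    (∀ R : ℝ, ∀ x : ℕ → ℝ → EuclideanSpace ℝ (Fin d),
      (∀ n, HolderOn (x n) γ a₀ b₀ ∧ cHolderNorm (x n) γ a₀ b₀ ≤ R) →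
      ∃ ns : ℕ → ℕ, StrictMono ns ∧ ∃ g : ℝ → EuclideanSpace ℝ (Fin d),
        HolderOn g τ a₀ b₀ ∧
        Filter.Tendsto (fun k => cHolderNorm (fun t => M (x (ns k)) t - g t) τ a₀ b₀)
          Filter.atTop (nhds 0)) := by
  obtain ⟨hτ0, hτ1⟩ := hτ
  obtain ⟨hlam0, hlam1⟩ := hlam
  obtain ⟨hγ0, hγ1⟩ := hγ
  obtain ⟨K, hK, hW1', hW2'⟩ := condW_bounds hτ0 hlam0 (hW a₀ (b₀ + 1) (by linarith))
  have hW1 : ∀ s t x y, a₀ ≤ s → s ≤ t → t ≤ b₀ → ‖W s x - W t x - W s y + W t y‖ ≤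
        K * ((1 + ‖x‖ + ‖y‖) ^ β * (t - s) ^ τ * ‖x - y‖ ^ lam) :=
    fun s t x y h1 h2 h3 => hW1' s t x y h1 h2 (by linarith)
  have hW2 : ∀ s t x, a₀ ≤ s → s ≤ t → t ≤ b₀ → ‖W s x - W t x‖ ≤
        K * ((1 + ‖x‖) ^ (β + lam) * (t - s) ^ τ) :=
    fun s t x h1 h2 h3 => hW2' s t x h1 h2 (by linarith)
  have hlg : 0 < lam * γ := mul_pos hlam0 hγ0
  obtain ⟨θ, hθ0, hθ1, hθ⟩ : ∃ θ : ℝ, 0 < θ ∧ θ < 1 ∧ 1 < τ + θ * (lam * γ) := by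
    have h1 : (1 - τ) / (lam * γ) < 1 := by rw [div_lt_one hlg]; linarith
    have h0 : 0 ≤ (1 - τ) / (lam * γ) := div_nonneg (by linarith) hlg.le
    obtain ⟨θ, h2, h3⟩ := exists_between h1
    refine ⟨θ, by linarith, h3, ?_⟩
    rw [div_lt_iff₀ hlg] at h2
    linarith
  have hsew : ∀ x, HolderOn x γ a₀ b₀ → M x t₀ = 0 ∧ IsSewn (youngGerm W x) (M x) a₀ b₀ t₀ :=
    fun x hx => isSewn_of_integral ht₀ (hM x hx)
  have hwlim : ∀ C : ℝ, Filter.Tendsto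
      (fun e : ℝ => C * (e ^ lam + (e ^ lam) ^ (1 - θ)) * ((b₀ - a₀) ^ τ + 1))
      (nhds 0) (nhds 0) := by
    intro C
    have h1 : Continuous (fun e : ℝ => e ^ lam) := Real.continuous_rpow_const hlam0.le
    have h2 : Continuous (fun e : ℝ => e ^ (1 - θ)) := Real.continuous_rpow_const (by linarith)
    have : Continuous (fun e : ℝ => C * (e ^ lam + (e ^ lam) ^ (1 - θ)) * ((b₀ - a₀) ^ τ + 1)) :=
      (continuous_const.mul (h1.add (h2.comp h1))).mul continuous_const
    have h3 := this.tendsto 0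
    rw [Real.zero_rpow hlam0.ne', Real.zero_rpow (by linarith)] at h3
    simpa using h3
  -- main estimate
  have main : ∀ R : ℝ, 0 ≤ R → ∃ C : ℝ, 0 ≤ C ∧ ∀ x y, HolderOn x γ a₀ b₀ → HolderOn y γ a₀ b₀ →
      GoodBd x γ a₀ b₀ R → GoodBd y γ a₀ b₀ R → ∀ e : ℝ, 0 ≤ e →
      (∀ t, a₀ ≤ t → t ≤ b₀ → ‖x t - y t‖ ≤ e) →
      cHolderNorm (fun t => M x t - M y t) τ a₀ b₀ ≤
        C * (e ^ lam + (e ^ lam) ^ (1 - θ)) * ((b₀ - a₀) ^ τ + 1) := by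
    intro R hR
    obtain ⟨C, hC, H⟩ := key_double (t₀ := t₀) hI hβ hτ0 hlam0 hγ0 hθ0 hθ1 hθ hK hR hW1
    refine ⟨C, hC, fun x y hx hy gx gy e he hxy => ?_⟩
    refine cHolderNorm_le hτ0 ht₀ ?_ (by positivity)
      (H x y (M x) (M y) e he gx gy hxy (hsew x hx).2 (hsew y hy).2)
    simp only [(hsew x hx).1, (hsew y hy).1, sub_zero]
  have nonneg : ∀ x : ℝ → EuclideanSpace ℝ (Fin d), ∀ κ, 0 ≤ cHolderNorm x κ a₀ b₀ := fun x κ =>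
    add_nonneg (supNorm_nonneg _ _ _) (holderSemi_nonneg _ _ _ _)
  have hMH : ∀ x, HolderOn x γ a₀ b₀ → HolderOn (M x) τ a₀ b₀ := by
    intro x hx
    obtain ⟨C, H⟩ := key_single (t₀ := t₀) hβ hτ0 hlam0 hγ0 hsum hK (nonneg x γ) hW1 hW2
    exact holderOn_of_le (H x (M x) (good_of_holder hγ0 hx le_rfl) (hsew x hx).2)
  refine ⟨hMH, ?_, ?_⟩
  · intro x hx ε hε
    have gx := good_of_holder hγ0 hx le_rfl
    set R := cHolderNorm x γ a₀ b₀ with hR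
    have hR0 : 0 ≤ R := nonneg x γ
    obtain ⟨C, hC, H⟩ := main (R + 1) (by linarith)
    obtain ⟨δ₀, hδ₀, hw⟩ := Metric.tendsto_nhds_nhds.1 (hwlim C) ε hε
    refine ⟨min 1 δ₀, by positivity, fun y hy hlt => ?_⟩
    have hz : HolderOn (fun t => y t - x t) γ a₀ b₀ := by
      refine holderOn_of_le (C := holderSemi y γ a₀ b₀ + holderSemi x γ a₀ b₀) ?_
      intro s t hs hst ht
      have h1 := holder_le hγ0 hy s t hs hst.le ht
      have h2 := holder_le hγ0 hx s t hs hst.le ht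
      rw [show y t - x t - (y s - x s) = (y t - y s) - (x t - x s) by abel, add_mul]
      exact (norm_sub_le _ _).trans (add_le_add h1 h2)
    have gz := good_of_holder hγ0 hz le_rfl
    set e := cHolderNorm (fun t => y t - x t) γ a₀ b₀ with he
    have he0 : 0 ≤ e := nonneg _ γ
    have he1 : e ≤ 1 := hlt.le.trans (min_le_left _ _)
    have he2 : e < δ₀ := hlt.trans_le (min_le_right _ _)
    have gx' : GoodBd x γ a₀ b₀ (R + 1) := by
      refine ⟨fun t h1 h2 => (gx.1 t h1 h2).trans (by linarith), fun s t h1 h2 h3 => ?_⟩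
      have : 0 ≤ (t - s) ^ γ := Real.rpow_nonneg (by linarith) _
      refine (gx.2 s t h1 h2 h3).trans (by gcongr; linarith)
    have gy' : GoodBd y γ a₀ b₀ (R + 1) := by
      refine ⟨fun t h1 h2 => ?_, fun s t h1 h2 h3 => ?_⟩
      · have h4 := gx.1 t h1 h2
        have h5 := gz.1 t h1 h2
        have h6 : ‖y t‖ ≤ ‖x t‖ + ‖y t - x t‖ := norm_le_norm_add_norm_sub' _ _
        simp only at h5
        linarith
      · have h4 := gx.2 s t h1 h2 h3
        have h5 := gz.2 s t h1 h2 h3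
        simp only at h5
        have h7 : 0 ≤ (t - s) ^ γ := Real.rpow_nonneg (by linarith) _
        have h6 := norm_add_le (x t - x s) (y t - x t - (y s - x s))
        rw [show (x t - x s) + (y t - x t - (y s - x s)) = y t - y s by abel] at h6
        nlinarith
    have h1 := H y x hy hx gy' gx' e he0 gz.1
    have h2 := hw (x := e) (by rw [Real.dist_eq, sub_zero, abs_of_nonneg he0]; exact he2)
    rw [Real.dist_eq, sub_zero] at h2
    exact h1.trans_lt ((le_abs_self _).trans_lt h2)
  · intro R x hx
    have gx : ∀ n, GoodBd (x n) γ a₀ b₀ R := fun n => good_of_holder hγ0 (hx n).1 (hx n).2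
    have hR : 0 ≤ R := (nonneg (x 0) γ).trans (hx 0).2
    obtain ⟨ns, hns, y, gy, e, he0, he, hxy⟩ := ascoli hI hγ0 x gx
    have hy : HolderOn y γ a₀ b₀ := holderOn_of_le fun s t h1 h2 h3 => gy.2 s t h1 h2.le h3
    obtain ⟨C, hC, H⟩ := main R hR
    refine ⟨ns, hns, M y, hMH y hy, ?_⟩
    exact squeeze_zero (fun k => nonneg _ τ)
      (fun k => H (x (ns k)) y (hx _).1 hy (gx _) gy (e k) (he0 k) (hxy k))
      ((hwlim C).comp he)

end
end

section
/- Uniqueness for nonlinear Young differential equations: Let W : ℝ × ℝ^d → ℝ^d satisfy condition (W) with τ, λ ∈ (0,1], τ + τλ > 1, W(t,·) differentiable in x for every t, and suppose that for every T > 0 and compact K ⊂ ℝ^d the quantity sup_{|s−t|>0, x ∈ K} |∇W(t,x) − ∇W(s,x)|/|t−s|^τ + sup_{|s−t|>0, x≠y ∈ K} |∇W(t,x) − ∇W(s,x) − ∇W(t,y) + ∇W(s,y)|/(|t−s|^τ |x−y|^λ) (suprema over s,t ∈ [t₀−T, t₀+T]) is finite. Then for every t₀, T and initial value, the equation φ_t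 = φ_{t₀} + ∫_{t₀}^t W(ds, φ_s) has at most one solution in C^τ([t₀−T, t₀+T]; ℝ^d). -/
open scoped BigOperators

noncomputable section

/-- `φ` solves the nonlinear Young differential equation
`φ_t = φ_{t₀} + ∫_{t₀}^t W(ds, φ_s)` on `[t₀ − T, t₀ + T]`. -/
def IsYoungSolution {d : ℕ}
    (W : ℝ → EuclideanSpace ℝ (Fin d) → EuclideanSpace ℝ (Fin d))
    (φ : ℝ → EuclideanSpace ℝ (Fin d)) (t₀ T : ℝ) : Prop :=
  ∀ t ∈ Set.Icc (t₀ - T) (t₀ + T), HasSignedYoungIntegral W φ t₀ t (φ t - φ t₀)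

/-- The spatial gradient `∇W(t,x)` (as a continuous linear map). -/
def gradW {d : ℕ} (W : ℝ → EuclideanSpace ℝ (Fin d) → EuclideanSpace ℝ (Fin d))
    (t : ℝ) (x : EuclideanSpace ℝ (Fin d)) :
    EuclideanSpace ℝ (Fin d) →L[ℝ] EuclideanSpace ℝ (Fin d) :=
  fderiv ℝ (W t) x

/-- Quotients of the first term of `‖∇W‖_{τ,λ;[a,b]×K}`. -/
def gradWSet1 {d : ℕ} (W : ℝ → EuclideanSpace ℝ (Fin d) → EuclideanSpace ℝ (Fin d))
    (τ a b : ℝ) (K : Set (EuclideanSpace ℝ (Fin d))) : Set ℝ :=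
  {r | ∃ (s t : ℝ) (x : EuclideanSpace ℝ (Fin d)), a ≤ s ∧ s < t ∧ t ≤ b ∧ x ∈ K ∧
    r = ‖gradW W t x - gradW W s x‖ / (t - s) ^ τ}

/-- Quotients of the second term of `‖∇W‖_{τ,λ;[a,b]×K}`. -/
def gradWSet2 {d : ℕ} (W : ℝ → EuclideanSpace ℝ (Fin d) → EuclideanSpace ℝ (Fin d))
    (τ lam a b : ℝ) (K : Set (EuclideanSpace ℝ (Fin d))) : Set ℝ :=
  {r | ∃ (s t : ℝ) (x y : EuclideanSpace ℝ (Fin d)),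
    a ≤ s ∧ s < t ∧ t ≤ b ∧ x ∈ K ∧ y ∈ K ∧ x ≠ y ∧
    r = ‖gradW W t x - gradW W s x - gradW W t y + gradW W s y‖ /
      ((t - s) ^ τ * ‖x - y‖ ^ lam)}

/-- Dyadic Riemann sums. -/
def dySum {E : Type*} [NormedAddCommGroup E] (μ : ℝ → ℝ → E) : ℕ → ℝ → ℝ → E
  | 0, s, t => μ s t
  | n + 1, s, t => dySum μ n s ((s + t) / 2) + dySum μ n ((s + t) / 2) t

/-- `x` is a Riemann sum over a partition of `[a,b]` of mesh less than `δ`. -/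
inductive RSum {E : Type*} [NormedAddCommGroup E] (μ : ℝ → ℝ → E) (δ : ℝ) : ℝ → ℝ → E → Prop
  | nil (a : ℝ) : RSum μ δ a a 0
  | cons (a b c : ℝ) (y : E) (hab : a < b) (hd : b - a < δ) (h : RSum μ δ b c y) :
      RSum μ δ a c (μ a b + y)

theorem RSum.append {E : Type*} [NormedAddCommGroup E] {μ : ℝ → ℝ → E} {δ a b c : ℝ} {x y : E}
    (h : RSum μ δ a b x) (h' : RSum μ δ b c y) : RSum μ δ a c (x + y) := by
  induction h with
  | nil a => simpa using h'
  | cons a b c' z hab hd _ ih =>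
    rw [add_assoc]
    exact RSum.cons a b c _ hab hd (ih h')

theorem RSum.exists_partition {E : Type*} [NormedAddCommGroup E] {μ : ℝ → ℝ → E} {δ a b : ℝ}
    {x : E} (hδ : 0 < δ) (h : RSum μ δ a b x) :
    ∃ (m : ℕ) (t : Fin (m + 1) → ℝ), IsPartition a b m t ∧ partMesh m t < δ ∧
      ∑ i : Fin m, μ (t i.castSucc) (t i.succ) = x := by
  suffices H : ∃ (m : ℕ) (t : Fin (m + 1) → ℝ), IsPartition a b m t ∧
      (∀ i : Fin m, t i.succ - t i.castSucc < δ) ∧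
      ∑ i : Fin m, μ (t i.castSucc) (t i.succ) = x by
    obtain ⟨m, t, h1, h2, h3⟩ := H
    refine ⟨m, t, h1, ?_, h3⟩
    unfold partMesh
    rcases isEmpty_or_nonempty (Fin m) with he | he
    · rw [Real.iSup_of_isEmpty]; exact hδ
    · obtain ⟨i, hi⟩ := exists_eq_ciSup_of_finite (f := fun i : Fin m => t i.succ - t i.castSucc)
      rw [← hi]; exact h2 i
  induction h with
  | nil a =>
    refine ⟨0, fun _ => a, ⟨?_, rfl, rfl⟩, ?_, ?_⟩
    · intro i j hij
      exact absurd hij (by omega)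
    · intro i; exact i.elim0
    · simp
  | cons a b c y hab hd _ ih =>
    obtain ⟨m, t, ⟨hmono, h0, hl⟩, h2, h3⟩ := ih
    refine ⟨m + 1, Fin.cons a t, ⟨?_, ?_, ?_⟩, ?_, ?_⟩
    · rw [Fin.strictMono_iff_lt_succ]
      intro i
      refine Fin.cases ?_ ?_ i
      · simpa [h0] using hab
      · intro j
        rw [← Fin.succ_castSucc, Fin.cons_succ, Fin.cons_succ]
        exact hmono j.castSucc_lt_succ
    · simp
    · rw [← Fin.succ_last, Fin.cons_succ, hl]
    · intro i
      refine Fin.cases ?_ ?_ i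
      · simpa [h0] using hd
      · intro j
        rw [← Fin.succ_castSucc, Fin.cons_succ, Fin.cons_succ]
        exact h2 j
    · rw [Fin.sum_univ_succ]
      rw [← h3]
      congr 1
      simp [h0]

theorem dySum_RSum {E : Type*} [NormedAddCommGroup E] (μ : ℝ → ℝ → E) (δ : ℝ) (n : ℕ) :
    ∀ s t : ℝ, s < t → (t - s) / 2 ^ n < δ → RSum μ δ s t (dySum μ n s t) := by
  induction n with
  | zero =>
    intro s t h hd
    have := RSum.cons (μ := μ) (δ := δ) s t t 0 h (by simpa using hd) (RSum.nil t)
    simpa [dySum] using this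
  | succ n ih =>
    intro s t h hd
    have e : (t - s) / 2 ^ (n + 1) = ((t - s) / 2) / 2 ^ n := by rw [pow_succ]; field_simp
    rw [e] at hd
    refine RSum.append (ih s ((s + t) / 2) (by linarith) ?_) (ih _ t (by linarith) ?_)
    · convert hd using 2; ring
    · convert hd using 2; ring

theorem eventually_mesh (L δ : ℝ) (hδ : 0 < δ) : ∀ᶠ n : ℕ in Filter.atTop, L / 2 ^ n < δ := by
  have : Filter.Tendsto (fun n : ℕ => L / 2 ^ n) Filter.atTop (nhds 0) := by
    have h := (tendsto_pow_atTop_nhds_zero_of_lt_one (r := (1 / 2 : ℝ)) (by norm_num)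
      (by norm_num)).const_mul L
    simpa [div_eq_mul_inv] using h
  exact this.eventually_lt_const hδ

theorem exists_RSum {E : Type*} [NormedAddCommGroup E] (μ : ℝ → ℝ → E) (δ : ℝ) (hδ : 0 < δ)
    (s t : ℝ) (h : s ≤ t) : ∃ x, RSum μ δ s t x := by
  rcases h.eq_or_lt with rfl | h
  · exact ⟨0, RSum.nil _⟩
  · obtain ⟨n, hn⟩ := (eventually_mesh (t - s) δ hδ).exists
    exact ⟨_, dySum_RSum μ δ n s t h hn⟩

theorem RiemannLimit.rsum {E : Type*} [NormedAddCommGroup E] {μ : ℝ → ℝ → E} {a b : ℝ} {I : E}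
    (h : RiemannLimit a b μ I) (ε : ℝ) (hε : 0 < ε) :
    ∃ δ : ℝ, 0 < δ ∧ ∀ δ' x, 0 < δ' → δ' ≤ δ → RSum μ δ' a b x → ‖x - I‖ < ε := by
  obtain ⟨δ, hδ, H⟩ := h ε hε
  refine ⟨δ, hδ, fun δ' x h0 hle hx => ?_⟩
  obtain ⟨m, t, h1, h2, h3⟩ := hx.exists_partition h0
  rw [← h3]
  exact H m t h1 (h2.trans_le hle)

theorem tendsto_right {E : Type*} [NormedAddCommGroup E] {μ : ℝ → ℝ → E} {a s t : ℝ} {I J : E}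
    (has : a ≤ s) (hst : s < t) (hI : RiemannLimit a s μ I) (hJ : RiemannLimit a t μ J) :
    Filter.Tendsto (fun n => dySum μ n s t) Filter.atTop (nhds (J - I)) := by
  rw [Metric.tendsto_nhds]
  intro ε hε
  obtain ⟨δ₁, hδ₁, H₁⟩ := hI.rsum (ε / 2) (by linarith)
  obtain ⟨δ₂, hδ₂, H₂⟩ := hJ.rsum (ε / 2) (by linarith)
  have hδ : 0 < min δ₁ δ₂ := lt_min hδ₁ hδ₂
  obtain ⟨x, hx⟩ := exists_RSum μ _ hδ a s has
  filter_upwards [eventually_mesh (t - s) _ hδ] with n hn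
  have hy := dySum_RSum μ _ n s t hst hn
  have h1 := H₁ _ _ hδ (min_le_left _ _) hx
  have h2 := H₂ _ _ hδ (min_le_right _ _) (hx.append hy)
  rw [dist_eq_norm]
  calc ‖dySum μ n s t - (J - I)‖ = ‖(x + dySum μ n s t - J) - (x - I)‖ := by congr 1; abel
    _ ≤ _ := norm_sub_le _ _
    _ < ε := by linarith

theorem tendsto_left {E : Type*} [NormedAddCommGroup E] {μ : ℝ → ℝ → E} {s t b : ℝ} {I J : E}
    (hst : s < t) (htb : t ≤ b) (hI : RiemannLimit t b μ I) (hJ : RiemannLimit s b μ J) :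
    Filter.Tendsto (fun n => dySum μ n s t) Filter.atTop (nhds (J - I)) := by
  rw [Metric.tendsto_nhds]
  intro ε hε
  obtain ⟨δ₁, hδ₁, H₁⟩ := hI.rsum (ε / 2) (by linarith)
  obtain ⟨δ₂, hδ₂, H₂⟩ := hJ.rsum (ε / 2) (by linarith)
  have hδ : 0 < min δ₁ δ₂ := lt_min hδ₁ hδ₂
  obtain ⟨x, hx⟩ := exists_RSum μ _ hδ t b htb
  filter_upwards [eventually_mesh (t - s) _ hδ] with n hn
  have hy := dySum_RSum μ _ n s t hst hn
  have h1 := H₁ _ _ hδ (min_le_left _ _) hx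
  have h2 := H₂ _ _ hδ (min_le_right _ _) (hy.append hx)
  rw [dist_eq_norm]
  calc ‖dySum μ n s t - (J - I)‖ = ‖(dySum μ n s t + x - J) - (x - I)‖ := by congr 1; abel
    _ ≤ _ := norm_sub_le _ _
    _ < ε := by linarith

theorem dySum_sub {E : Type*} [NormedAddCommGroup E] (μ ν : ℝ → ℝ → E) (n : ℕ) : ∀ s t : ℝ,
    dySum (fun s t => μ s t - ν s t) n s t = dySum μ n s t - dySum ν n s t := by
  induction n with
  | zero => intro s t; rfl
  | succ n ih => intro s t; simp only [dySum, ih]; abel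

/-- Dyadic sewing estimate. -/
theorem dySum_bound {E : Type*} [NormedAddCommGroup E] (μ : ℝ → ℝ → E) (θ C A a b : ℝ)
    (hC : C * (2 * (1 / 2) ^ θ) + 1 ≤ C) (hA : 0 ≤ A)
    (hμ : ∀ s t, a ≤ s → s < t → t ≤ b →
      ‖μ s ((s + t) / 2) + μ ((s + t) / 2) t - μ s t‖ ≤ A * (t - s) ^ θ) (hC0 : 0 ≤ C) (n : ℕ) :
    ∀ s t, a ≤ s → s < t → t ≤ b → ‖dySum μ n s t - μ s t‖ ≤ C * A * (t - s) ^ θ := by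
  induction n with
  | zero =>
    intro s t _ h _
    have : 0 ≤ (t - s) ^ θ := Real.rpow_nonneg (by linarith) _
    simp only [dySum, sub_self, norm_zero]
    positivity
  | succ n ih =>
    intro s t hs h ht
    have e1 : ((s + t) / 2 - s) ^ θ = (1 / 2) ^ θ * (t - s) ^ θ := by
      rw [← Real.mul_rpow (by norm_num) (by linarith)]; congr 1; ring
    have e2 : (t - (s + t) / 2) ^ θ = (1 / 2) ^ θ * (t - s) ^ θ := by
      rw [← Real.mul_rpow (by norm_num) (by linarith)]; congr 1; ring
    have i1 := ih s ((s + t) / 2) hs (by linarith) (by linarith)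
    have i2 := ih ((s + t) / 2) t (by linarith) (by linarith) ht
    have i3 := hμ s t hs h ht
    rw [e1] at i1
    rw [e2] at i2
    have h0 : 0 ≤ A * (t - s) ^ θ := mul_nonneg hA (Real.rpow_nonneg (by linarith) _)
    have key := mul_le_mul_of_nonneg_right hC h0
    calc ‖dySum μ (n + 1) s t - μ s t‖
        = ‖(dySum μ n s ((s + t) / 2) - μ s ((s + t) / 2)) +
            (dySum μ n ((s + t) / 2) t - μ ((s + t) / 2) t) +
            (μ s ((s + t) / 2) + μ ((s + t) / 2) t - μ s t)‖ := by
          congr 1; simp only [dySum]; abel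
      _ ≤ _ := norm_add₃_le
      _ ≤ _ := add_le_add (add_le_add i1 i2) i3
      _ ≤ C * A * (t - s) ^ θ := by linarith

theorem four_point {E : Type*} [NormedAddCommGroup E] [NormedSpace ℝ E] (F : E → E)
    (hF : Differentiable ℝ F) (K : Set E) (hK : Convex ℝ K) (m lam D : ℝ) (hlam : 0 ≤ lam)
    (hm : 0 ≤ m)
    (h1 : ∀ x ∈ K, ‖fderiv ℝ F x‖ ≤ m)
    (h2 : ∀ x ∈ K, ∀ y ∈ K, ‖fderiv ℝ F x - fderiv ℝ F y‖ ≤ m * ‖x - y‖ ^ lam)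
    (x₁ y₁ x₂ y₂ : E) (hx₁ : x₁ ∈ K) (hy₁ : y₁ ∈ K) (hx₂ : x₂ ∈ K) (hy₂ : y₂ ∈ K)
    (hx : ‖x₁ - x₂‖ ≤ D) (hy : ‖y₁ - y₂‖ ≤ D) :
    ‖(F x₁ - F y₁) - (F x₂ - F y₂)‖ ≤
      m * (‖(x₁ - y₁) - (x₂ - y₂)‖ + D ^ lam * ‖x₂ - y₂‖) := by
  have hd : ∀ x y : E, ∀ r : ℝ, HasDerivAt (fun r : ℝ => F (y + r • (x - y)))
      (fderiv ℝ F (y + r • (x - y)) (x - y)) r := by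
    intro x y r
    have hg : HasDerivAt (fun r : ℝ => y + r • (x - y)) (x - y) r := by
      simpa using ((hasDerivAt_id r).smul_const (x - y)).const_add y
    exact (hF _).hasFDerivAt.comp_hasDerivAt r hg
  have hmem : ∀ x ∈ K, ∀ y ∈ K, ∀ r ∈ Set.Icc (0 : ℝ) 1, y + r • (x - y) ∈ K :=
    fun x hx y hy r hr => hK.add_smul_sub_mem hy hx hr
  have key := norm_image_sub_le_of_norm_deriv_le_segment_01'
    (f := fun r : ℝ => F (y₁ + r • (x₁ - y₁)) - F (y₂ + r • (x₂ - y₂)))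
    (f' := fun r => fderiv ℝ F (y₁ + r • (x₁ - y₁)) (x₁ - y₁) -
      fderiv ℝ F (y₂ + r • (x₂ - y₂)) (x₂ - y₂))
    (C := m * (‖(x₁ - y₁) - (x₂ - y₂)‖ + D ^ lam * ‖x₂ - y₂‖))
    (fun r _ => ((hd x₁ y₁ r).sub (hd x₂ y₂ r)).hasDerivWithinAt) ?_
  · simp only [one_smul, zero_smul, add_zero, add_sub_cancel] at key
    convert key using 2
    abel
  · intro r hr
    have hr' : r ∈ Set.Icc (0 : ℝ) 1 := ⟨hr.1, hr.2.le⟩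
    set p := y₁ + r • (x₁ - y₁) with hp
    set q := y₂ + r • (x₂ - y₂) with hq
    have hpK : p ∈ K := hmem _ hx₁ _ hy₁ r hr'
    have hqK : q ∈ K := hmem _ hx₂ _ hy₂ r hr'
    have hpq : ‖p - q‖ ≤ D := by
      have : p - q = (1 - r) • (y₁ - y₂) + r • (x₁ - x₂) := by
        rw [hp, hq]; module
      rw [this]
      refine (norm_add_le _ _).trans ?_
      rw [norm_smul, norm_smul, Real.norm_of_nonneg hr.1,
        Real.norm_of_nonneg (by linarith [hr.2] : (0 : ℝ) ≤ 1 - r)]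
      nlinarith [hr.1, hr.2]
    have e : fderiv ℝ F p (x₁ - y₁) - fderiv ℝ F q (x₂ - y₂) =
        fderiv ℝ F p ((x₁ - y₁) - (x₂ - y₂)) + (fderiv ℝ F p - fderiv ℝ F q) (x₂ - y₂) := by
      simp
    rw [e, mul_add]
    refine (norm_add_le _ _).trans (add_le_add ?_ ?_)
    · exact ((fderiv ℝ F p).le_opNorm _).trans
        (mul_le_mul_of_nonneg_right (h1 p hpK) (norm_nonneg _))
    · refine ((fderiv ℝ F p - fderiv ℝ F q).le_opNorm _).trans ?_
      rw [← mul_assoc]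
      refine mul_le_mul_of_nonneg_right ((h2 p hpK q hqK).trans ?_) (norm_nonneg _)
      exact mul_le_mul_of_nonneg_left (Real.rpow_le_rpow (norm_nonneg _) hpq hlam) hm

/-- Halving step. -/
theorem half_step {E : Type*} [NormedAddCommGroup E] [NormedSpace ℝ E]
    (W : ℝ → E → E) (hdiff : ∀ t, Differentiable ℝ (W t)) (φ ψ : ℝ → E)
    (τ lam M H C L a b c Q : ℝ) (K : Set E) (hK : Convex ℝ K)
    (hτ0 : 0 < τ) (hlam0 : 0 < lam) (hlam1 : lam ≤ 1)
    (hM : 0 ≤ M) (hH : 0 ≤ H) (hC0 : 0 ≤ C) (hQ : 0 ≤ Q)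
    (hC : C * (2 * (1 / 2) ^ (τ + τ * lam)) + 1 ≤ C)
    (hL0 : 0 < L) (hL1 : L ≤ 1)
    (hL : (M + C * (M * (1 + H ^ lam))) * L ^ (τ * lam) ≤ 1 / 2)
    (hab : b - a ≤ L) (hc : c ∈ Set.Icc a b)
    (hG1 : ∀ s t, a ≤ s → s < t → t ≤ b → ∀ x ∈ K,
      ‖fderiv ℝ (fun z => W t z - W s z) x‖ ≤ M * (t - s) ^ τ)
    (hG2 : ∀ s t, a ≤ s → s < t → t ≤ b → ∀ x ∈ K, ∀ y ∈ K,
      ‖fderiv ℝ (fun z => W t z - W s z) x - fderiv ℝ (fun z => W t z - W s z) y‖ ≤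
        M * (t - s) ^ τ * ‖x - y‖ ^ lam)
    (hφK : ∀ t ∈ Set.Icc a b, φ t ∈ K) (hψK : ∀ t ∈ Set.Icc a b, ψ t ∈ K)
    (hφH : ∀ s t, a ≤ s → s < t → t ≤ b → ‖φ t - φ s‖ ≤ H * (t - s) ^ τ)
    (hψH : ∀ s t, a ≤ s → s < t → t ≤ b → ‖ψ t - ψ s‖ ≤ H * (t - s) ^ τ)
    (hφl : ∀ s t, a ≤ s → s < t → t ≤ b →
      Filter.Tendsto (fun n => dySum (fun s t => W t (φ s) - W s (φ s)) n s t)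
        Filter.atTop (nhds (φ t - φ s)))
    (hψl : ∀ s t, a ≤ s → s < t → t ≤ b →
      Filter.Tendsto (fun n => dySum (fun s t => W t (ψ s) - W s (ψ s)) n s t)
        Filter.atTop (nhds (ψ t - ψ s)))
    (hu : φ c = ψ c)
    (hQu : ∀ s t, a ≤ s → s < t → t ≤ b →
      ‖(φ t - ψ t) - (φ s - ψ s)‖ ≤ Q * (t - s) ^ τ) :
    ∀ s t, a ≤ s → s < t → t ≤ b →
      ‖(φ t - ψ t) - (φ s - ψ s)‖ ≤ (Q / 2) * (t - s) ^ τ := by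
  have hLτ0 : 0 ≤ L ^ τ := Real.rpow_nonneg hL0.le _
  have hLτ1 : L ^ τ ≤ 1 := Real.rpow_le_one hL0.le hL1 hτ0.le
  -- sup bound
  have hsup : ∀ t ∈ Set.Icc a b, ‖φ t - ψ t‖ ≤ Q * L ^ τ := by
    intro t ht
    rcases lt_trichotomy t c with h | h | h
    · have := hQu t c ht.1 h hc.2
      rw [hu, sub_self, zero_sub, norm_neg] at this
      exact this.trans (mul_le_mul_of_nonneg_left
        (Real.rpow_le_rpow (by linarith) (by linarith [ht.1, hc.2]) hτ0.le) hQ)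
    · rw [h, hu, sub_self, norm_zero]; positivity
    · have := hQu c t hc.1 h ht.2
      rw [hu, sub_self, sub_zero] at this
      exact this.trans (mul_le_mul_of_nonneg_left
        (Real.rpow_le_rpow (by linarith) (by linarith [ht.2, hc.1]) hτ0.le) hQ)
  set μ : ℝ → ℝ → E := fun s t => (W t (φ s) - W s (φ s)) - (W t (ψ s) - W s (ψ s)) with hμ
  have hdF : ∀ s t, Differentiable ℝ (fun z => W t z - W s z) := fun s t => (hdiff t).sub (hdiff s)
  set A := M * (Q * (1 + H ^ lam)) with hA
  have hHl : 0 ≤ H ^ lam := Real.rpow_nonneg hH _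
  have hA0 : 0 ≤ A := by positivity
  have hdelta : ∀ s t, a ≤ s → s < t → t ≤ b →
      ‖μ s ((s + t) / 2) + μ ((s + t) / 2) t - μ s t‖ ≤ A * (t - s) ^ (τ + τ * lam) := by
    intro s t hs hst ht
    set r := (s + t) / 2 with hr
    have hsr : s < r := by linarith
    have hrt : r < t := by linarith
    have hh0 : 0 < t - s := by linarith
    have hh1 : t - s ≤ 1 := by linarith
    have hX : 0 ≤ (t - s) ^ τ := Real.rpow_nonneg hh0.le _
    have hY : 0 ≤ (t - s) ^ (τ * lam) := Real.rpow_nonneg hh0.le _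
    have hrs : (r - s) ^ τ ≤ (t - s) ^ τ := Real.rpow_le_rpow (by linarith) (by linarith) hτ0.le
    have htr : (t - r) ^ τ ≤ (t - s) ^ τ := Real.rpow_le_rpow (by linarith) (by linarith) hτ0.le
    have hXY : (t - s) ^ τ ≤ (t - s) ^ (τ * lam) :=
      Real.rpow_le_rpow_of_exponent_ge hh0 hh1 (by nlinarith)
    have hsI : s ∈ Set.Icc a b := ⟨hs, by linarith⟩
    have hrI : r ∈ Set.Icc a b := ⟨by linarith, by linarith⟩
    have fp := four_point (fun z => W t z - W r z) (hdF r t) K hK (M * (t - r) ^ τ) lam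
      (H * (t - s) ^ τ) hlam0.le (mul_nonneg hM (Real.rpow_nonneg (by linarith) _))
      (hG1 r t (by linarith) hrt ht) (hG2 r t (by linarith) hrt ht)
      (φ r) (ψ r) (φ s) (ψ s) (hφK r hrI) (hψK r hrI) (hφK s hsI) (hψK s hsI)
      ((hφH s r hs hsr (by linarith)).trans (mul_le_mul_of_nonneg_left hrs hH))
      ((hψH s r hs hsr (by linarith)).trans (mul_le_mul_of_nonneg_left hrs hH))
    have e : μ s r + μ r t - μ s t = (W t (φ r) - W r (φ r) - (W t (ψ r) - W r (ψ r))) -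
        (W t (φ s) - W r (φ s) - (W t (ψ s) - W r (ψ s))) := by
      simp only [hμ]; abel
    rw [e]
    refine fp.trans ?_
    have hu1 : ‖(φ r - ψ r) - (φ s - ψ s)‖ ≤ Q * (t - s) ^ (τ * lam) :=
      (hQu s r hs hsr (by linarith)).trans (mul_le_mul_of_nonneg_left (hrs.trans hXY) hQ)
    have hu2 : ‖φ s - ψ s‖ ≤ Q := (hsup s hsI).trans (by nlinarith)
    have hD : (H * (t - s) ^ τ) ^ lam = H ^ lam * (t - s) ^ (τ * lam) := by
      rw [Real.mul_rpow hH hX, ← Real.rpow_mul hh0.le]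
    rw [hD, Real.rpow_add hh0]
    calc M * (t - r) ^ τ * (‖(φ r - ψ r) - (φ s - ψ s)‖ +
          H ^ lam * (t - s) ^ (τ * lam) * ‖φ s - ψ s‖)
        ≤ M * (t - s) ^ τ * (Q * (t - s) ^ (τ * lam) + H ^ lam * (t - s) ^ (τ * lam) * Q) := by
          gcongr
      _ = A * ((t - s) ^ τ * (t - s) ^ (τ * lam)) := by rw [hA]; ring
  intro s t hs hst ht
  have hlim : Filter.Tendsto (fun n => dySum μ n s t) Filter.atTop
      (nhds ((φ t - φ s) - (ψ t - ψ s))) := by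
    have := (hφl s t hs hst ht).sub (hψl s t hs hst ht)
    refine this.congr fun n => ?_
    rw [hμ, dySum_sub (fun s t => W t (φ s) - W s (φ s)) (fun s t => W t (ψ s) - W s (ψ s))]
  have hbd := le_of_tendsto ((hlim.sub_const (μ s t)).norm) (Filter.Eventually.of_forall fun n =>
    dySum_bound μ (τ + τ * lam) C A a b hC hA0 hdelta hC0 n s t hs hst ht)
  have hh0 : 0 < t - s := by linarith
  have hX : 0 ≤ (t - s) ^ τ := Real.rpow_nonneg hh0.le _
  have hsI : s ∈ Set.Icc a b := ⟨hs, by linarith⟩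
  have hμb : ‖μ s t‖ ≤ M * (t - s) ^ τ * (Q * L ^ τ) := by
    have := hK.norm_image_sub_le_of_norm_fderiv_le (𝕜 := ℝ)
      (f := fun z => W t z - W s z) (fun x _ => hdF s t x) (hG1 s t hs hst ht)
      (hψK s hsI) (hφK s hsI)
    exact this.trans (mul_le_mul_of_nonneg_left (hsup s hsI) (mul_nonneg hM hX))
  have hLL : L ^ τ ≤ L ^ (τ * lam) := Real.rpow_le_rpow_of_exponent_ge hL0 hL1 (by nlinarith)
  have hYL : (t - s) ^ (τ * lam) ≤ L ^ (τ * lam) :=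
    Real.rpow_le_rpow hh0.le (by linarith) (by positivity)
  rw [Real.rpow_add hh0] at hbd
  calc ‖(φ t - ψ t) - (φ s - ψ s)‖ = ‖((φ t - φ s) - (ψ t - ψ s) - μ s t) + μ s t‖ := by
        congr 1; abel
    _ ≤ _ := norm_add_le _ _
    _ ≤ C * A * ((t - s) ^ τ * (t - s) ^ (τ * lam)) + M * (t - s) ^ τ * (Q * L ^ τ) :=
        add_le_add hbd hμb
    _ ≤ C * A * ((t - s) ^ τ * L ^ (τ * lam)) + M * (t - s) ^ τ * (Q * L ^ (τ * lam)) := by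
        gcongr
    _ = (Q * (t - s) ^ τ) * ((M + C * (M * (1 + H ^ lam))) * L ^ (τ * lam)) := by
        rw [hA]; ring
    _ ≤ (Q * (t - s) ^ τ) * (1 / 2) := mul_le_mul_of_nonneg_left hL (by positivity)
    _ = _ := by ring

theorem zero_of_interval {E : Type*} [NormedAddCommGroup E] [NormedSpace ℝ E]
    (W : ℝ → E → E) (hdiff : ∀ t, Differentiable ℝ (W t)) (φ ψ : ℝ → E)
    (τ lam M H A B c : ℝ) (K : Set E) (hK : Convex ℝ K)
    (hτ0 : 0 < τ) (hlam0 : 0 < lam) (hlam1 : lam ≤ 1) (hsum : 1 < τ + τ * lam)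
    (hM : 0 ≤ M) (hH : 0 ≤ H) (hc : c ∈ Set.Icc A B)
    (hG1 : ∀ s t, A ≤ s → s < t → t ≤ B → ∀ x ∈ K,
      ‖fderiv ℝ (fun z => W t z - W s z) x‖ ≤ M * (t - s) ^ τ)
    (hG2 : ∀ s t, A ≤ s → s < t → t ≤ B → ∀ x ∈ K, ∀ y ∈ K,
      ‖fderiv ℝ (fun z => W t z - W s z) x - fderiv ℝ (fun z => W t z - W s z) y‖ ≤
        M * (t - s) ^ τ * ‖x - y‖ ^ lam)
    (hφK : ∀ t ∈ Set.Icc A B, φ t ∈ K) (hψK : ∀ t ∈ Set.Icc A B, ψ t ∈ K)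
    (hφH : ∀ s t, A ≤ s → s < t → t ≤ B → ‖φ t - φ s‖ ≤ H * (t - s) ^ τ)
    (hψH : ∀ s t, A ≤ s → s < t → t ≤ B → ‖ψ t - ψ s‖ ≤ H * (t - s) ^ τ)
    (hφl : ∀ s t, A ≤ s → s < t → t ≤ B →
      Filter.Tendsto (fun n => dySum (fun s t => W t (φ s) - W s (φ s)) n s t)
        Filter.atTop (nhds (φ t - φ s)))
    (hψl : ∀ s t, A ≤ s → s < t → t ≤ B →
      Filter.Tendsto (fun n => dySum (fun s t => W t (ψ s) - W s (ψ s)) n s t)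
        Filter.atTop (nhds (ψ t - ψ s)))
    (hu : φ c = ψ c) : ∀ t ∈ Set.Icc A B, φ t = ψ t := by
  -- the sewing constant
  obtain ⟨C, hC0, hC⟩ : ∃ C : ℝ, 0 ≤ C ∧ C * (2 * (1 / 2) ^ (τ + τ * lam)) + 1 ≤ C := by
    have h : 2 * (1 / 2 : ℝ) ^ (τ + τ * lam) < 1 := by
      have := Real.rpow_lt_rpow_of_exponent_gt (x := (1 / 2 : ℝ)) (by norm_num) (by norm_num) hsum
      rw [Real.rpow_one] at this
      linarith
    refine ⟨(1 - 2 * (1 / 2 : ℝ) ^ (τ + τ * lam))⁻¹, ?_, ?_⟩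
    · exact inv_nonneg.2 (by linarith)
    · have h' : (1 - 2 * (1 / 2 : ℝ) ^ (τ + τ * lam)) ≠ 0 := by linarith
      have := inv_mul_cancel₀ h'
      rw [mul_sub, mul_one] at this
      linarith
  -- the step length
  obtain ⟨L, hL0, hL1, hL⟩ : ∃ L : ℝ, 0 < L ∧ L ≤ 1 ∧
      (M + C * (M * (1 + H ^ lam))) * L ^ (τ * lam) ≤ 1 / 2 := by
    have hcont : Filter.Tendsto (fun L : ℝ => (M + C * (M * (1 + H ^ lam))) * L ^ (τ * lam))
        (nhdsWithin 0 (Set.Ioi 0)) (nhds 0) := by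
      have h1 : ContinuousAt (fun L : ℝ => (M + C * (M * (1 + H ^ lam))) * L ^ (τ * lam)) 0 :=
        (Real.continuousAt_rpow_const 0 (τ * lam) (Or.inr (by positivity))).const_mul _
      have h2 := h1.tendsto
      rw [Real.zero_rpow (by positivity), mul_zero] at h2
      exact h2.mono_left nhdsWithin_le_nhds
    have e1 := hcont.eventually_lt_const (show (0 : ℝ) < 1 / 2 by norm_num)
    have e2 : ∀ᶠ L : ℝ in nhdsWithin 0 (Set.Ioi 0), L ∈ Set.Ioc (0 : ℝ) 1 :=
      Ioc_mem_nhdsGT one_pos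
    obtain ⟨L, h1, h2⟩ := (e1.and e2).exists
    exact ⟨L, h2.1, h2.2, h1.le⟩
  -- local statement
  have hloc : ∀ a b c, A ≤ a → b ≤ B → b - a ≤ L → c ∈ Set.Icc a b → φ c = ψ c →
      ∀ s t, a ≤ s → s < t → t ≤ b → φ t - ψ t = φ s - ψ s := by
    intro a b c hAa hbB hab hc hu
    have hit : ∀ n : ℕ, ∀ s t, a ≤ s → s < t → t ≤ b →
        ‖(φ t - ψ t) - (φ s - ψ s)‖ ≤ (2 * H / 2 ^ n) * (t - s) ^ τ := by
      intro n
      induction n with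
      | zero =>
        intro s t hs hst ht
        have h1 := hφH s t (by linarith) hst (by linarith)
        have h2 := hψH s t (by linarith) hst (by linarith)
        calc ‖(φ t - ψ t) - (φ s - ψ s)‖ = ‖(φ t - φ s) - (ψ t - ψ s)‖ := by congr 1; abel
          _ ≤ _ := norm_sub_le _ _
          _ ≤ _ := add_le_add h1 h2
          _ = _ := by simp; ring
      | succ n ih =>
        have e : 2 * H / 2 ^ (n + 1) = (2 * H / 2 ^ n) / 2 := by rw [pow_succ]; field_simp
        rw [e]
        exact half_step W hdiff φ ψ τ lam M H C L a b c (2 * H / 2 ^ n) K hK hτ0 hlam0 hlam1 hM hH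
          hC0 (by positivity) hC hL0 hL1 hL hab hc
          (fun s t h1 h2 h3 => hG1 s t (by linarith) h2 (by linarith))
          (fun s t h1 h2 h3 => hG2 s t (by linarith) h2 (by linarith))
          (fun t ht => hφK t ⟨by linarith [ht.1], by linarith [ht.2]⟩)
          (fun t ht => hψK t ⟨by linarith [ht.1], by linarith [ht.2]⟩)
          (fun s t h1 h2 h3 => hφH s t (by linarith) h2 (by linarith))
          (fun s t h1 h2 h3 => hψH s t (by linarith) h2 (by linarith))
          (fun s t h1 h2 h3 => hφl s t (by linarith) h2 (by linarith))
          (fun s t h1 h2 h3 => hψl s t (by linarith) h2 (by linarith)) hu ih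
    intro s t hs hst ht
    have hlim : Filter.Tendsto (fun n : ℕ => (2 * H / 2 ^ n) * (t - s) ^ τ) Filter.atTop
        (nhds 0) := by
      have h := ((tendsto_pow_atTop_nhds_zero_of_lt_one (r := (1 / 2 : ℝ)) (by norm_num)
        (by norm_num)).const_mul (2 * H)).mul_const ((t - s) ^ τ)
      simpa [div_eq_mul_inv] using h
    have h0 := ge_of_tendsto' hlim (fun n => hit n s t hs hst ht)
    exact sub_eq_zero.1 (norm_le_zero_iff.1 h0)
  have hall : ∀ n : ℕ, ∀ t ∈ Set.Icc A B, |t - c| ≤ n * L → φ t = ψ t := by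
    intro n
    induction n with
    | zero =>
      intro t _ h
      have h' : |t - c| ≤ 0 := by simpa using h
      rw [sub_eq_zero.1 (abs_nonpos_iff.1 h'), hu]
    | succ n ih =>
      intro t ht h
      push_cast at h
      have hnL : 0 ≤ (n : ℝ) * L := by positivity
      rw [abs_le] at h
      rcases lt_trichotomy t c with hlt | heq | hgt
      · have hm : φ (min c (t + L)) = ψ (min c (t + L)) := by
          apply ih
          · exact ⟨le_min hc.1 (by linarith [ht.1]), (min_le_left _ _).trans hc.2⟩
          · rw [abs_le]
            rcases min_cases c (t + L) with ⟨h1, _⟩ | ⟨h1, h2⟩ <;> rw [h1] <;>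
              constructor <;> linarith
        have hlt' : t < min c (t + L) := lt_min hlt (by linarith)
        have := hloc t (min c (t + L)) (min c (t + L)) ht.1 ((min_le_left _ _).trans hc.2)
          (by linarith [min_le_right c (t + L)]) ⟨hlt'.le, le_rfl⟩ hm t _ le_rfl hlt' le_rfl
        rw [hm, sub_self] at this
        exact sub_eq_zero.1 this.symm
      · rw [heq, hu]
      · have hm : φ (max c (t - L)) = ψ (max c (t - L)) := by
          apply ih
          · exact ⟨hc.1.trans (le_max_left _ _), max_le hc.2 (by linarith [ht.2])⟩
          · rw [abs_le]
            rcases max_cases c (t - L) with ⟨h1, _⟩ | ⟨h1, h2⟩ <;> rw [h1] <;>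
              constructor <;> linarith
        have hlt' : max c (t - L) < t := max_lt hgt (by linarith)
        have := hloc (max c (t - L)) t (max c (t - L)) (hc.1.trans (le_max_left _ _)) ht.2
          (by linarith [le_max_right c (t - L)]) ⟨le_rfl, hlt'.le⟩ hm _ t le_rfl hlt' le_rfl
        rw [hm, sub_self] at this
        exact sub_eq_zero.1 this
  intro t ht
  obtain ⟨n, hn⟩ := exists_nat_ge (|t - c| / L)
  exact hall n t ht ((div_le_iff₀ hL0).1 hn)

theorem HolderOn.exists_bound {F : Type*} [NormedAddCommGroup F] {φ : ℝ → F} {γ a b : ℝ}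
    (h : HolderOn φ γ a b) : ∃ H : ℝ, 0 ≤ H ∧
      ∀ s t, a ≤ s → s < t → t ≤ b → ‖φ t - φ s‖ ≤ H * (t - s) ^ γ := by
  obtain ⟨H, hH⟩ := h
  refine ⟨max H 0, le_max_right _ _, fun s t hs hst ht => ?_⟩
  have h1 := hH ⟨s, t, hs, hst, ht, rfl⟩
  have hp : 0 < (t - s) ^ γ := Real.rpow_pos_of_pos (by linarith) _
  rw [div_le_iff₀ hp] at h1
  exact h1.trans (mul_le_mul_of_nonneg_right (le_max_left _ _) hp.le)

theorem holder_bounded {F : Type*} [NormedAddCommGroup F] {φ : ℝ → F} {γ a b H c : ℝ}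
    (hγ : 0 ≤ γ) (hH : 0 ≤ H) (hc : c ∈ Set.Icc a b)
    (h : ∀ s t, a ≤ s → s < t → t ≤ b → ‖φ t - φ s‖ ≤ H * (t - s) ^ γ) :
    ∀ t ∈ Set.Icc a b, ‖φ t‖ ≤ ‖φ c‖ + H * (b - a) ^ γ := by
  intro t ht
  have hba : 0 ≤ b - a := by linarith [hc.1, hc.2]
  have key : ‖φ t - φ c‖ ≤ H * (b - a) ^ γ := by
    rcases lt_trichotomy t c with h1 | h1 | h1
    · rw [norm_sub_rev]
      exact (h t c ht.1 h1 hc.2).trans (mul_le_mul_of_nonneg_left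
        (Real.rpow_le_rpow (by linarith) (by linarith [ht.1, hc.2]) hγ) hH)
    · rw [h1, sub_self, norm_zero]; positivity
    · exact (h c t hc.1 h1 ht.2).trans (mul_le_mul_of_nonneg_left
        (Real.rpow_le_rpow (by linarith) (by linarith [ht.2, hc.1]) hγ) hH)
  have := norm_add_le (φ c) (φ t - φ c)
  rw [add_sub_cancel] at this
  linarith

theorem IsYoungSolution.tendsto_fwd {d : ℕ}
    {W : ℝ → EuclideanSpace ℝ (Fin d) → EuclideanSpace ℝ (Fin d)}
    {φ : ℝ → EuclideanSpace ℝ (Fin d)} {t₀ T : ℝ} (h : IsYoungSolution W φ t₀ T) (hT : 0 < T) :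
    ∀ s t, t₀ ≤ s → s < t → t ≤ t₀ + T →
      Filter.Tendsto (fun n => dySum (fun s t => W t (φ s) - W s (φ s)) n s t)
        Filter.atTop (nhds (φ t - φ s)) := by
  have hR : ∀ t, t₀ ≤ t → t ≤ t₀ + T → RiemannLimit t₀ t (youngGerm W φ) (φ t - φ t₀) := by
    intro t h1 h2
    rcases h t ⟨by linarith, h2⟩ with h' | h'
    · exact h'.2
    · exact absurd h'.1 (by linarith)
  intro s t hs hst ht
  have := tendsto_right hs hst (hR s hs (by linarith)) (hR t (by linarith) ht)
  rw [sub_sub_sub_cancel_right] at this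
  exact this

theorem IsYoungSolution.tendsto_bwd {d : ℕ}
    {W : ℝ → EuclideanSpace ℝ (Fin d) → EuclideanSpace ℝ (Fin d)}
    {φ : ℝ → EuclideanSpace ℝ (Fin d)} {t₀ T : ℝ} (h : IsYoungSolution W φ t₀ T) (hT : 0 < T) :
    ∀ s t, t₀ - T ≤ s → s < t → t ≤ t₀ →
      Filter.Tendsto (fun n => dySum (fun s t => W t (φ s) - W s (φ s)) n s t)
        Filter.atTop (nhds (φ t - φ s)) := by
  have hR : ∀ t, t₀ - T ≤ t → t ≤ t₀ → RiemannLimit t t₀ (youngGerm W φ) (-(φ t - φ t₀)) := by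
    intro t h1 h2
    rcases h t ⟨h1, by linarith⟩ with h' | h'
    · have e : t₀ = t := le_antisymm h'.1 h2
      have := h'.2
      subst e
      simpa [HasYoungIntegral] using this
    · exact h'.2
  intro s t hs hst ht
  have := tendsto_left hst ht (hR t (by linarith) ht) (hR s hs (by linarith))
  have e : -(φ s - φ t₀) - -(φ t - φ t₀) = φ t - φ s := by abel
  rw [e] at this
  exact this

/-- **Uniqueness for nonlinear Young differential equations** (Corollary 3.3): under
condition (W) with `τ + τλ > 1`, spatial differentiability of `W`, and finiteness of the
joint Hölder seminorms of `∇W` on `[t₀−T, t₀+T] × K` for every compact `K`, the equation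
`φ_t = φ_{t₀} + ∫_{t₀}^t W(ds, φ_s)` has at most one solution in `C^τ([t₀−T, t₀+T])`
for each initial value. -/
theorem young_ode_uniqueness
    (τ lam : ℝ) (hτ : τ ∈ Set.Ioc (0 : ℝ) 1) (hlam : lam ∈ Set.Ioc (0 : ℝ) 1)
    (hsum : 1 < τ + τ * lam)
    (d : ℕ) (W : ℝ → EuclideanSpace ℝ (Fin d) → EuclideanSpace ℝ (Fin d)) (β : ℝ)
    (hβ : 0 ≤ β) (hW : ∀ a b : ℝ, a < b → ConditionW W β τ lam a b)
    (hdiff : ∀ t : ℝ, Differentiable ℝ (W t))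
    (t₀ T : ℝ) (hT : 0 < T)
    (hgrad : ∀ K : Set (EuclideanSpace ℝ (Fin d)), IsCompact K →
      BddAbove (gradWSet1 W τ (t₀ - T) (t₀ + T) K) ∧
      BddAbove (gradWSet2 W τ lam (t₀ - T) (t₀ + T) K))
    (φ ψ : ℝ → EuclideanSpace ℝ (Fin d))
    (hφ : HolderOn φ τ (t₀ - T) (t₀ + T)) (hψ : HolderOn ψ τ (t₀ - T) (t₀ + T))
    (hφsol : IsYoungSolution W φ t₀ T) (hψsol : IsYoungSolution W ψ t₀ T)
    (hinit : φ t₀ = ψ t₀) :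
    ∀ t ∈ Set.Icc (t₀ - T) (t₀ + T), φ t = ψ t := by
  obtain ⟨H₁, hH₁, hφH⟩ := hφ.exists_bound
  obtain ⟨H₂, hH₂, hψH⟩ := hψ.exists_bound
  set A := t₀ - T with hA
  set B := t₀ + T with hB
  have ht₀ : t₀ ∈ Set.Icc A B := ⟨by linarith, by linarith⟩
  have hφb := holder_bounded hτ.1.le hH₁ ht₀ hφH
  have hψb := holder_bounded hτ.1.le hH₂ ht₀ hψH
  obtain ⟨R, hR⟩ : ∃ R, R = max (‖φ t₀‖ + H₁ * (B - A) ^ τ) (‖ψ t₀‖ + H₂ * (B - A) ^ τ) := ⟨_, rfl⟩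
  set K : Set (EuclideanSpace ℝ (Fin d)) := Metric.closedBall 0 R with hK
  have hφK : ∀ t ∈ Set.Icc A B, φ t ∈ K := fun t ht => by
    rw [hK, mem_closedBall_zero_iff, hR]
    exact (hφb t ht).trans (le_max_left _ _)
  have hψK : ∀ t ∈ Set.Icc A B, ψ t ∈ K := fun t ht => by
    rw [hK, mem_closedBall_zero_iff, hR]
    exact (hψb t ht).trans (le_max_right _ _)
  obtain ⟨⟨M₁, hM₁⟩, ⟨M₂, hM₂⟩⟩ := hgrad K (isCompact_closedBall _ _)
  set M := max 0 (max M₁ M₂) with hM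
  have hM0 : 0 ≤ M := le_max_left _ _
  have hM1 : M₁ ≤ M := (le_max_left _ _).trans (le_max_right _ _)
  have hM2 : M₂ ≤ M := (le_max_right _ _).trans (le_max_right _ _)
  have hfd : ∀ s t x, fderiv ℝ (fun z => W t z - W s z) x = gradW W t x - gradW W s x :=
    fun s t x => fderiv_fun_sub (hdiff t x) (hdiff s x)
  have hG1 : ∀ s t, A ≤ s → s < t → t ≤ B → ∀ x ∈ K,
      ‖fderiv ℝ (fun z => W t z - W s z) x‖ ≤ M * (t - s) ^ τ := by
    intro s t hs hst ht x hx
    have hp : 0 < (t - s) ^ τ := Real.rpow_pos_of_pos (by linarith) _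
    have h := (hM₁ ⟨s, t, x, hs, hst, ht, hx, rfl⟩).trans hM1
    rw [div_le_iff₀ hp] at h
    rw [hfd]
    exact h
  have hG2 : ∀ s t, A ≤ s → s < t → t ≤ B → ∀ x ∈ K, ∀ y ∈ K,
      ‖fderiv ℝ (fun z => W t z - W s z) x - fderiv ℝ (fun z => W t z - W s z) y‖ ≤
        M * (t - s) ^ τ * ‖x - y‖ ^ lam := by
    intro s t hs hst ht x hx y hy
    have hp : 0 < (t - s) ^ τ := Real.rpow_pos_of_pos (by linarith) _
    rcases eq_or_ne x y with rfl | hxy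
    · rw [sub_self, norm_zero]
      have := Real.rpow_nonneg (norm_nonneg (x - x)) lam
      positivity
    · have hq : 0 < ‖x - y‖ ^ lam := Real.rpow_pos_of_pos (norm_pos_iff.2 (sub_ne_zero.2 hxy)) _
      have h := (hM₂ ⟨s, t, x, y, hs, hst, ht, hx, hy, hxy, rfl⟩).trans hM2
      rw [div_le_iff₀ (mul_pos hp hq), ← mul_assoc] at h
      rw [hfd, hfd]
      refine le_of_eq_of_le ?_ h
      congr 1
      abel
  set H := max H₁ H₂ with hHdef
  have hH0 : 0 ≤ H := hH₁.trans (le_max_left _ _)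
  have hφH' : ∀ s t, A ≤ s → s < t → t ≤ B → ‖φ t - φ s‖ ≤ H * (t - s) ^ τ :=
    fun s t hs hst ht => (hφH s t hs hst ht).trans (mul_le_mul_of_nonneg_right (le_max_left _ _)
      (Real.rpow_nonneg (by linarith) _))
  have hψH' : ∀ s t, A ≤ s → s < t → t ≤ B → ‖ψ t - ψ s‖ ≤ H * (t - s) ^ τ :=
    fun s t hs hst ht => (hψH s t hs hst ht).trans (mul_le_mul_of_nonneg_right (le_max_right _ _)
      (Real.rpow_nonneg (by linarith) _))
  have hconv : Convex ℝ K := convex_closedBall _ _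
  intro t ht
  rcases le_total t₀ t with h | h
  · exact zero_of_interval W hdiff φ ψ τ lam M H t₀ B t₀ K hconv hτ.1 hlam.1 hlam.2 hsum hM0 hH0
      ⟨le_rfl, ht₀.2⟩
      (fun s t h1 h2 h3 => hG1 s t (by linarith) h2 h3)
      (fun s t h1 h2 h3 => hG2 s t (by linarith) h2 h3)
      (fun t ht => hφK t ⟨by linarith [ht.1], ht.2⟩)
      (fun t ht => hψK t ⟨by linarith [ht.1], ht.2⟩)
      (fun s t h1 h2 h3 => hφH' s t (by linarith) h2 h3)
      (fun s t h1 h2 h3 => hψH' s t (by linarith) h2 h3)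
      (hφsol.tendsto_fwd hT) (hψsol.tendsto_fwd hT) hinit t ⟨h, ht.2⟩
  · exact zero_of_interval W hdiff φ ψ τ lam M H A t₀ t₀ K hconv hτ.1 hlam.1 hlam.2 hsum hM0 hH0
      ⟨ht₀.1, le_rfl⟩
      (fun s t h1 h2 h3 => hG1 s t h1 h2 (by linarith))
      (fun s t h1 h2 h3 => hG2 s t h1 h2 (by linarith))
      (fun t ht => hφK t ⟨ht.1, by linarith [ht.2]⟩)
      (fun t ht => hψK t ⟨ht.1, by linarith [ht.2]⟩)
      (fun s t h1 h2 h3 => hφH' s t h1 h2 (by linarith))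
      (fun s t h1 h2 h3 => hψH' s t h1 h2 (by linarith))
      (hφsol.tendsto_bwd hT) (hψsol.tendsto_bwd hT) hinit t ⟨ht.1, h⟩

end
end
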